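/- arXiv:math/0406093 — 2 statements merged into one kernel-verified Lean document; each statement's English description precedes it below -/
import Mathlib

section
/- If n ≥ 2, d_1, d_2 ∈ ℂ \ {0} with d_1²/d_2² ∉ ℝ, and a continuous map f : ℂⁿ → ℂⁿ preserves distance d_1 and preserves distance d_2, then f is an affine map with orthogonal linear part, i.e., f is affine over ℂ and φ_n(f(X), f(Y)) = φ_n(X, Y) for all X, Y ∈ ℂⁿ. -/
/-- φ_n(X,Y) = Σ_{i=1}^n (x_i − y_i)². -/
noncomputable def phi (n : ℕ) (X Y : Fin n → ℂ) : ℂ := ∑ i, (X i - Y i) ^ 2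

open Matrix

namespace BQ

lemma eq_zero_of_perp {n : ℕ} (b : Fin n → (Fin n → ℂ)) (hb : LinearIndependent ℂ b)
    (w : Fin n → ℂ) (hw : ∀ i, w ⬝ᵥ b i = 0) : w = 0 := by
  have hs : Submodule.span ℂ (Set.range b) = ⊤ :=
    hb.span_eq_top_of_card_eq_finrank' (by simp)
  have h : ∀ x, w ⬝ᵥ x = 0 := by
    intro x
    have hx : x ∈ Submodule.span ℂ (Set.range b) := by rw [hs]; trivial
    induction hx using Submodule.span_induction with
    | mem x h => obtain ⟨i, rfl⟩ := h; exact hw i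
    | zero => simp
    | add x y _ _ h1 h2 => rw [dotProduct_add, h1, h2, add_zero]
    | smul a x _ h => rw [dotProduct_smul, h, smul_zero]
  ext i
  have := h (Pi.single i 1)
  simpa using this

lemma exists_iso {n : ℕ} (u v : Fin n → ℂ) (h : u ⬝ᵥ u = v ⬝ᵥ v) (h0 : v ⬝ᵥ v ≠ 0) :
    ∃ T : (Fin n → ℂ) →ₗ[ℂ] (Fin n → ℂ), (∀ x y, T x ⬝ᵥ T y = x ⬝ᵥ y) ∧ T u = v := by
  have key : ∀ w : Fin n → ℂ, w ⬝ᵥ w ≠ 0 → ∃ T : (Fin n → ℂ) →ₗ[ℂ] (Fin n → ℂ),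
      (∀ x y, T x ⬝ᵥ T y = x ⬝ᵥ y) ∧ ∀ x, T x = x - (2 * (x ⬝ᵥ w) / (w ⬝ᵥ w)) • w := by
    intro w hw
    refine ⟨{ toFun := fun x => x - (2 * (x ⬝ᵥ w) / (w ⬝ᵥ w)) • w, map_add' := ?_, map_smul' := ?_ },
      ?_, fun x => rfl⟩
    · intro x y
      ext i
      simp only [add_dotProduct, Pi.add_apply, Pi.sub_apply, Pi.smul_apply, smul_eq_mul]
      ring
    · intro a x
      ext i
      simp only [smul_dotProduct, Pi.sub_apply, Pi.smul_apply, smul_eq_mul, RingHom.id_apply]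
      ring
    · intro x y
      simp only [LinearMap.coe_mk, AddHom.coe_mk, sub_dotProduct, dotProduct_sub, smul_dotProduct,
        dotProduct_smul, smul_eq_mul, dotProduct_comm w y]
      field_simp
      ring
  by_cases hc : (u - v) ⬝ᵥ (u - v) = 0
  · have hw : (u + v) ⬝ᵥ (u + v) ≠ 0 := by
      intro h2
      apply h0
      simp only [add_dotProduct, dotProduct_add, sub_dotProduct, dotProduct_sub] at hc h2
      linear_combination (hc + h2) / 4 - h / 2
    obtain ⟨T, hT, hT'⟩ := key _ hw
    refine ⟨-T, ?_, ?_⟩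
    · intro x y
      simp [hT]
    · have e : 2 * (u ⬝ᵥ (u + v)) / ((u + v) ⬝ᵥ (u + v)) = 1 := by
        rw [div_eq_one_iff_eq hw]
        simp only [add_dotProduct, dotProduct_add, dotProduct_comm v u]
        linear_combination h
      rw [LinearMap.neg_apply, hT', e]
      simp
  · obtain ⟨T, hT, hT'⟩ := key _ hc
    refine ⟨T, hT, ?_⟩
    have e : 2 * (u ⬝ᵥ (u - v)) / ((u - v) ⬝ᵥ (u - v)) = 1 := by
      rw [div_eq_one_iff_eq hc]
      simp only [sub_dotProduct, dotProduct_sub, dotProduct_comm v u]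
      linear_combination h
    rw [hT', e]
    simp

lemma exists_sq (z : ℂ) : ∃ w : ℂ, w ^ 2 = z := IsAlgClosed.exists_pow_nat_eq z (by norm_num)

lemma exists_frame {n : ℕ} (hn : 2 ≤ n) (v : Fin n → ℂ) (h0 : v ⬝ᵥ v ≠ 0) :
    ∃ r : Fin n → (Fin n → ℂ), (∀ i, r i ⬝ᵥ v = 0) ∧ (∑ i, r i = 0) ∧
      ∀ i j, r i ⬝ᵥ r j = (if i = j then 1 else 0) - 1 / (n : ℂ) := by
  have hn0 : (n : ℂ) ≠ 0 := by
    have : n ≠ 0 := by omega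
    exact_mod_cast this
  obtain ⟨s, hs⟩ := exists_sq ((v ⬝ᵥ v) / n)
  obtain ⟨T, hT, hTu⟩ := exists_iso (fun _ : Fin n => s) v (by
    simp only [dotProduct, Finset.sum_const, Finset.card_univ, Fintype.card_fin, nsmul_eq_mul]
    simp only [dotProduct] at hs
    rw [← sq, hs]; field_simp) h0
  let e : Fin n → (Fin n → ℂ) := fun i => Pi.single i 1 - fun _ => 1 / (n : ℂ)
  refine ⟨fun i => T (e i), ?_, ?_, ?_⟩
  · intro i
    rw [← hTu, hT]
    simp only [e, sub_dotProduct, single_dotProduct]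
    simp [dotProduct]
    field_simp
    simp
  · rw [← map_sum]
    have : ∑ i, e i = 0 := by
      ext j
      simp [e, Finset.sum_apply, Pi.single_apply, hn0]
    rw [this, map_zero]
  · intro i j
    rw [hT]
    simp only [e, sub_dotProduct, dotProduct_sub, single_dotProduct, dotProduct_single]
    simp only [dotProduct, Pi.sub_apply, Pi.single_apply, Finset.sum_const, Finset.card_univ,
      Fintype.card_fin, nsmul_eq_mul, eq_comm (a := j) (b := i)]
    split_ifs <;> field_simp <;> ring

lemma exists_third {n : ℕ} (hn : 2 ≤ n) (v : Fin n → ℂ) (h0 : v ⬝ᵥ v ≠ 0) (c₁ c₂ : ℂ) :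
    ∃ w : Fin n → ℂ, w ⬝ᵥ w = c₁ ∧ (w - v) ⬝ᵥ (w - v) = c₂ := by
  obtain ⟨r, hr1, -, hr3⟩ := exists_frame hn v h0
  let i0 : Fin n := ⟨0, by omega⟩
  let i1 : Fin n := ⟨1, by omega⟩
  have h01 : i0 ≠ i1 := by simp [i0, i1]
  set u := r i0 - r i1 with hu
  have huv : u ⬝ᵥ v = 0 := by simp [hu, sub_dotProduct, hr1]
  have huu : u ⬝ᵥ u = 2 := by
    simp only [hu, sub_dotProduct, dotProduct_sub, hr3, h01, h01.symm, if_true, if_false]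
    ring
  have hvu : v ⬝ᵥ u = 0 := by rw [dotProduct_comm]; exact huv
  set g := v ⬝ᵥ v with hg
  set s : ℂ := ((c₁ - c₂) / g + 1) / 2 with hs
  have hs' : (2 * s - 1) * g = c₁ - c₂ := by rw [hs]; field_simp; ring
  obtain ⟨t, ht⟩ := exists_sq ((c₁ - s ^ 2 * g) / 2)
  refine ⟨s • v + t • u, ?_, ?_⟩ <;>
  simp only [add_dotProduct, dotProduct_add, sub_dotProduct, dotProduct_sub, smul_dotProduct,
    dotProduct_smul, smul_eq_mul, huv, hvu, huu, ← hg]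
  · linear_combination 2 * ht
  · linear_combination 2 * ht - hs'

lemma simplex_centered {n : ℕ} (hn : 2 ≤ n) (q : Fin n → (Fin n → ℂ)) (c e : ℂ) (hc : c ≠ 0)
    (hq0 : ∑ i, q i = 0)
    (hq : ∀ i j, (q i - q j) ⬝ᵥ (q i - q j) = if i = j then 0 else c)
    (x y : Fin n → ℂ) (hx : ∀ i, (x - q i) ⬝ᵥ (x - q i) = e)
    (hy : ∀ i, (y - q i) ⬝ᵥ (y - q i) = e) (hxy : x ≠ y) :
    x + y = 0 ∧ x ⬝ᵥ x = e - c * (n - 1) / (2 * n) := by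
  have hn0 : (n : ℂ) ≠ 0 := by
    have : n ≠ 0 := by omega
    exact_mod_cast this
  have hsum : ∀ z : Fin n → ℂ, ∑ j, z ⬝ᵥ q j = 0 := by
    intro z
    rw [← dotProduct_sum, hq0, dotProduct_zero]
  set S := ∑ j, q j ⬝ᵥ q j with hS
  have h1 : ∀ i, n * (q i ⬝ᵥ q i) + S = c * (n - 1) := by
    intro i
    have h2 : ∑ j, (q i - q j) ⬝ᵥ (q i - q j) = ∑ j, if i = j then 0 else c :=
      Finset.sum_congr rfl fun j _ => hq i j
    have h3 : ∀ j, (q i - q j) ⬝ᵥ (q i - q j) = q i ⬝ᵥ q i - 2 * (q i ⬝ᵥ q j) + q j ⬝ᵥ q j := by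
      intro j
      simp only [sub_dotProduct, dotProduct_sub, dotProduct_comm (q j) (q i)]
      ring
    have h4 : ∀ j, (if i = j then 0 else c) = c - if i = j then c else 0 := by
      intro j; split_ifs <;> simp
    simp only [h3, h4, Finset.sum_add_distrib, Finset.sum_sub_distrib, ← Finset.mul_sum, hsum,
      Finset.sum_const, Finset.card_univ, Fintype.card_fin, nsmul_eq_mul, Finset.sum_ite_eq,
      Finset.mem_univ, if_true, ← hS] at h2
    linear_combination h2
  have hS2 : S = c * (n - 1) / 2 := by
    have h2 : ∑ i, (n * (q i ⬝ᵥ q i) + S) = ∑ i : Fin n, c * ((n : ℂ) - 1) :=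
      Finset.sum_congr rfl fun j _ => h1 j
    simp only [Finset.sum_add_distrib, ← Finset.mul_sum, ← hS, Finset.sum_const, Finset.card_univ, Fintype.card_fin, nsmul_eq_mul] at h2
    have : (n : ℂ) * (S * 2) = n * (c * (n - 1)) := by linear_combination h2
    have := mul_left_cancel₀ hn0 this
    linear_combination this / 2
  have hqq : ∀ i, q i ⬝ᵥ q i = c * (n - 1) / (2 * n) := by
    intro i
    have := h1 i
    rw [hS2] at this
    field_simp
    linear_combination 2 * this
  have hpt : ∀ z : Fin n → ℂ, (∀ i, (z - q i) ⬝ᵥ (z - q i) = e) →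
      z ⬝ᵥ z = e - c * (n - 1) / (2 * n) ∧ ∀ i, z ⬝ᵥ q i = 0 := by
    intro z hz
    have h3 : ∀ j, z ⬝ᵥ z - 2 * (z ⬝ᵥ q j) + q j ⬝ᵥ q j = e := by
      intro j
      rw [← hz j]
      simp only [sub_dotProduct, dotProduct_sub, dotProduct_comm (q j) z]
      ring
    have h2 : ∑ j, (z ⬝ᵥ z - 2 * (z ⬝ᵥ q j) + q j ⬝ᵥ q j) = ∑ j : Fin n, e :=
      Finset.sum_congr rfl fun j _ => h3 j
    simp only [Finset.sum_add_distrib, Finset.sum_sub_distrib, ← Finset.mul_sum, hsum,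
      Finset.sum_const, Finset.card_univ, Fintype.card_fin, nsmul_eq_mul, ← hS, hS2] at h2
    have hzz : z ⬝ᵥ z = e - c * (n - 1) / (2 * n) := by
      field_simp
      linear_combination 2 * h2
    refine ⟨hzz, fun i => ?_⟩
    have := h3 i
    rw [hzz, hqq] at this
    linear_combination -this / 2
  obtain ⟨hxx, hxq⟩ := hpt x hx
  obtain ⟨hyy, hyq⟩ := hpt y hy
  refine ⟨?_, hxx⟩
  apply eq_zero_of_perp (fun i => q i + (x - y))
  · rw [Fintype.linearIndependent_iff]
    intro g hg
    have hij : ∀ i j, q i ⬝ᵥ q j = c / 2 * ((if i = j then 1 else 0) - 1 / n) := by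
      intro i j
      have := hq i j
      simp only [sub_dotProduct, dotProduct_sub, dotProduct_comm (q j) (q i), hqq] at this
      split_ifs at this ⊢ with h
      · subst h; rw [hqq]; field_simp
      · field_simp at this ⊢
        linear_combination - this / 2
    have hgj : ∀ j, g j = (∑ i, g i) / n := by
      intro j
      have h1 : (∑ i, g i • (q i + (x - y))) ⬝ᵥ q j = 0 := by rw [hg, zero_dotProduct]
      simp only [sum_dotProduct, smul_dotProduct, add_dotProduct, sub_dotProduct, hxq, hyq, hij,
        smul_eq_mul] at h1
      have h2 : c / 2 * (g j - (∑ i, g i) / n) = 0 := by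
        rw [← h1, Finset.sum_div]
        have : g j = ∑ i, if i = j then g i else 0 := by simp
        rw [this, ← Finset.sum_sub_distrib, Finset.mul_sum]
        apply Finset.sum_congr rfl
        intro i _
        split_ifs <;> ring
      have h3 := (mul_eq_zero.mp h2).resolve_left (div_ne_zero hc two_ne_zero)
      linear_combination h3
    have hG : (∑ i, g i) • (x - y) = 0 := by
      have h1 : ∑ i, g i • q i = 0 := by
        have : ∀ i, g i • q i = ((∑ i, g i) / n) • q i := fun i => by rw [← hgj i]
        simp only [this, ← Finset.smul_sum, hq0, smul_zero]
      simp only [smul_add, Finset.sum_add_distrib, h1, ← Finset.sum_smul, zero_add] at hg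
      exact hg
    have hG0 := (smul_eq_zero.mp hG).resolve_right (sub_ne_zero.mpr hxy)
    intro i
    rw [hgj, hG0, zero_div]
  · intro i
    simp only [dotProduct_add, add_dotProduct, dotProduct_sub, hxq, hyq, hxx, hyy, dotProduct_comm y x]
    ring

lemma simplex_reflect {n : ℕ} (hn : 2 ≤ n) (p : Fin n → (Fin n → ℂ)) (c e : ℂ) (hc : c ≠ 0)
    (hp : ∀ i j, i ≠ j → (p i - p j) ⬝ᵥ (p i - p j) = c)
    (X Y : Fin n → ℂ) (hx : ∀ i, (X - p i) ⬝ᵥ (X - p i) = e)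
    (hy : ∀ i, (Y - p i) ⬝ᵥ (Y - p i) = e) (hxy : X ≠ Y) :
    X + Y = (2 / (n : ℂ)) • ∑ i, p i ∧ (X - Y) ⬝ᵥ (X - Y) = 4 * e - 2 * (n - 1) / n * c := by
  have hn0 : (n : ℂ) ≠ 0 := by
    have : n ≠ 0 := by omega
    exact_mod_cast this
  set m : Fin n → ℂ := (1 / (n : ℂ)) • ∑ i, p i with hm
  have h := simplex_centered hn (fun i => p i - m) c e hc (by
      rw [Finset.sum_sub_distrib, hm, Finset.sum_const, Finset.card_univ, Fintype.card_fin,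
        ← Nat.cast_smul_eq_nsmul ℂ, smul_smul, mul_one_div_cancel hn0, one_smul, sub_self])
    (by
      intro i j
      rw [sub_sub_sub_cancel_right]
      split_ifs with h
      · simp [h]
      · exact hp i j h)
    (X - m) (Y - m) (fun i => by rw [sub_sub_sub_cancel_right]; exact hx i)
    (fun i => by rw [sub_sub_sub_cancel_right]; exact hy i) (by simpa using hxy)
  obtain ⟨h1, h2⟩ := h
  constructor
  · have : (2 / (n : ℂ)) • ∑ i, p i = m + m := by
      rw [hm, ← add_smul]; congr 1; ring
    rw [this, ← sub_eq_zero, ← h1]; abel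
  · have : X - Y = (2 : ℂ) • (X - m) := by
      have h3 : Y - m = - (X - m) := by rw [eq_neg_iff_add_eq_zero, add_comm]; exact h1
      calc X - Y = (X - m) - (Y - m) := by abel
        _ = _ := by rw [h3, two_smul]; abel
    rw [this, smul_dotProduct, dotProduct_smul, h2]
    simp only [smul_eq_mul]
    field_simp
    ring

end BQ

namespace BQ

def Pres {n : ℕ} (f : (Fin n → ℂ) → (Fin n → ℂ)) (c : ℂ) : Prop :=
  ∀ X Y : Fin n → ℂ, (X - Y) ⬝ᵥ (X - Y) = c → (f X - f Y) ⬝ᵥ (f X - f Y) = c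

lemma natC {n : ℕ} (hn : 2 ≤ n) : (n : ℂ) ≠ 0 := by
  have : n ≠ 0 := by omega
  exact_mod_cast this

lemma smul_self_dot {n : ℕ} (a : ℂ) (v : Fin n → ℂ) : (a • v) ⬝ᵥ (a • v) = a ^ 2 * (v ⬝ᵥ v) := by
  simp only [smul_dotProduct, dotProduct_smul, smul_eq_mul]; ring

lemma reflect_f {n : ℕ} (hn : 2 ≤ n) {f : (Fin n → ℂ) → (Fin n → ℂ)} {c e : ℂ} (hc : c ≠ 0)
    (pc : Pres f c) (pe : Pres f e) (x v : Fin n → ℂ) (γ : ℂ) (r : Fin n → (Fin n → ℂ))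
    (hr1 : ∀ i, r i ⬝ᵥ v = 0)
    (hr3 : ∀ i j, r i ⬝ᵥ r j = (if i = j then 1 else 0) - 1 / (n : ℂ))
    (hγ : γ ^ 2 = c / 2) (hv : v ⬝ᵥ v + c / 2 * (1 - 1 / n) = e)
    (hne : f (x + v) ≠ f (x - v)) :
    f (x + v) + f (x - v) = (2 / (n : ℂ)) • ∑ i, f (x + γ • r i) ∧
    (f (x + v) - f (x - v)) ⬝ᵥ (f (x + v) - f (x - v)) = 4 * e - 2 * (n - 1) / n * c := by
  have hr2 : ∀ i, v ⬝ᵥ r i = 0 := fun i => by rw [dotProduct_comm]; exact hr1 i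
  refine simplex_reflect hn (fun i => f (x + γ • r i)) c e hc ?_ _ _ ?_ ?_ hne
  · intro i j hij
    apply pc
    rw [add_sub_add_left_eq_sub, ← smul_sub, smul_self_dot]
    simp only [sub_dotProduct, dotProduct_sub, hr3, hij, hij.symm, if_true, if_false, hγ]
    ring
  · intro i
    apply pe
    rw [add_sub_add_left_eq_sub]
    simp only [sub_dotProduct, dotProduct_sub, smul_dotProduct, dotProduct_smul, hr1, hr2, hr3,
      if_true, smul_eq_mul]
    linear_combination hv + (1 - 1 / (n : ℂ)) * hγ
  · intro i
    apply pe
    have : x - v - (x + γ • r i) = - (v + γ • r i) := by abel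
    rw [this, neg_dotProduct_neg]
    simp only [add_dotProduct, dotProduct_add, smul_dotProduct, dotProduct_smul, hr1, hr2, hr3,
      if_true, smul_eq_mul]
    linear_combination hv + (1 - 1 / (n : ℂ)) * hγ

lemma step {n : ℕ} (hn : 2 ≤ n) {f : (Fin n → ℂ) → (Fin n → ℂ)} {c e : ℂ} (hc : c ≠ 0)
    (pc : Pres f c) (pe : Pres f e) (hg : 4 * e - 2 * (n - 1) / n * c ≠ 0) (X Y : Fin n → ℂ)
    (hXY : (X - Y) ⬝ᵥ (X - Y) = 4 * e - 2 * (n - 1) / n * c) (hne : f X ≠ f Y) :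
    (f X - f Y) ⬝ᵥ (f X - f Y) = 4 * e - 2 * (n - 1) / n * c := by
  have hn0 := natC hn
  set v : Fin n → ℂ := (1 / 2 : ℂ) • (X - Y) with hv
  set x : Fin n → ℂ := (1 / 2 : ℂ) • (X + Y) with hx
  have h1 : x + v = X := by ext i; simp [hv, hx]; ring
  have h2 : x - v = Y := by ext i; simp [hv, hx]; ring
  have hvv : v ⬝ᵥ v = (4 * e - 2 * (n - 1) / n * c) / 4 := by
    rw [hv, smul_self_dot, hXY]; ring
  obtain ⟨r, hr1, -, hr3⟩ := exists_frame hn v (by rw [hvv]; exact div_ne_zero hg (by norm_num))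
  obtain ⟨γ, hγ⟩ := exists_sq (c / 2)
  have := (reflect_f hn hc pc pe x v γ r hr1 hr3 hγ (by rw [hvv]; field_simp; ring)
    (by rw [h1, h2]; exact hne)).2
  rwa [h1, h2] at this

/-- third point, for pairs of points -/
lemma third {n : ℕ} (hn : 2 ≤ n) (X Y : Fin n → ℂ) (h0 : (X - Y) ⬝ᵥ (X - Y) ≠ 0) (c₁ c₂ : ℂ) :
    ∃ w : Fin n → ℂ, (X - w) ⬝ᵥ (X - w) = c₁ ∧ (Y - w) ⬝ᵥ (Y - w) = c₂ := by
  obtain ⟨w, h1, h2⟩ := exists_third hn (X - Y) h0 c₁ c₂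
  refine ⟨X - w, ?_, ?_⟩
  · rw [← h1]; congr 1 <;> abel
  · rw [← h2]
    have : Y - (X - w) = w - (X - Y) := by abel
    rw [this]

lemma lam_facts {n : ℕ} (hn : 2 ≤ n) : (4 - 2 * ((n : ℂ) - 1) / n) = 2 * (n + 1) / n ∧
    (2 * ((n : ℂ) + 1) / n) ≠ 0 ∧ (2 * ((n : ℂ) + 1) / n) ≠ 1 := by
  have hn0 := natC hn
  refine ⟨by field_simp; ring, ?_, ?_⟩
  · have : (n : ℂ) + 1 ≠ 0 := by exact_mod_cast Nat.succ_ne_zero n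
    exact div_ne_zero (mul_ne_zero two_ne_zero this) hn0
  · intro h
    field_simp at h
    have h' : (2 : ℕ) * (n + 1) = n := by exact_mod_cast h
    omega

lemma pres_lam {n : ℕ} (hn : 2 ≤ n) {f : (Fin n → ℂ) → (Fin n → ℂ)} {a : ℂ} (ha : a ≠ 0)
    (pa : Pres f a) : Pres f (2 * (n + 1) / n * a) := by
  obtain ⟨h1, h2, h3⟩ := lam_facts hn
  have e : 4 * a - 2 * ((n : ℂ) - 1) / n * a = 2 * (n + 1) / n * a := by
    rw [← h1]; ring
  have hg : 4 * a - 2 * ((n : ℂ) - 1) / n * a ≠ 0 := by rw [e]; exact mul_ne_zero h2 ha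
  rw [← e]
  intro X Y hXY
  apply step hn ha pa pa hg X Y hXY
  intro hf
  obtain ⟨w, hw1, hw2⟩ := third hn X Y (by rw [hXY]; exact hg)
    (4 * a - 2 * ((n : ℂ) - 1) / n * a) a
  have k1 := pa _ _ hw2
  rw [← hf] at k1
  by_cases hfw : f X = f w
  · rw [hfw] at k1
    simp at k1
    exact ha k1.symm
  · have := step hn ha pa pa hg X w hw1 hfw
    rw [k1, e] at this
    apply h3
    exact mul_right_cancel₀ ha (by rw [← this, one_mul])

lemma inj {n : ℕ} (hn : 2 ≤ n) {f : (Fin n → ℂ) → (Fin n → ℂ)} {a : ℂ} (ha : a ≠ 0)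
    (pa : Pres f a) (X Y : Fin n → ℂ) (h0 : (X - Y) ⬝ᵥ (X - Y) ≠ 0) : f X ≠ f Y := by
  intro hf
  obtain ⟨h1, h2, h3⟩ := lam_facts hn
  obtain ⟨w, hw1, hw2⟩ := third hn X Y h0 (2 * (n + 1) / n * a) a
  have k1 := pa _ _ hw2
  have k2 := pres_lam hn ha pa _ _ hw1
  rw [hf, k1] at k2
  exact h3 (mul_right_cancel₀ ha (by rw [← k2, one_mul]))

lemma pres_step {n : ℕ} (hn : 2 ≤ n) {f : (Fin n → ℂ) → (Fin n → ℂ)} {c e : ℂ} (hc : c ≠ 0)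
    (pc : Pres f c) (pe : Pres f e) (hg : 4 * e - 2 * (n - 1) / n * c ≠ 0) :
    Pres f (4 * e - 2 * (n - 1) / n * c) := by
  intro X Y hXY
  exact step hn hc pc pe hg X Y hXY (inj hn hc pc X Y (by rw [hXY]; exact hg))

lemma pres_small {n : ℕ} (hn : 2 ≤ n) {f : (Fin n → ℂ) → (Fin n → ℂ)} {a : ℂ} (ha : a ≠ 0)
    (pa : Pres f a) : Pres f ((2 / n) ^ 2 * a) := by
  have hn0 := natC hn
  obtain ⟨h1, h2, h3⟩ := lam_facts hn
  have e : 4 * a - 2 * ((n : ℂ) - 1) / n * (2 * (n + 1) / n * a) = (2 / n) ^ 2 * a := by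
    field_simp; ring
  rw [← e]
  apply pres_step hn (mul_ne_zero h2 ha) (pres_lam hn ha pa) pa
  rw [e]
  exact mul_ne_zero (pow_ne_zero 2 (div_ne_zero two_ne_zero hn0)) ha

lemma pres_small_pow {n : ℕ} (hn : 2 ≤ n) {f : (Fin n → ℂ) → (Fin n → ℂ)} {a : ℂ} (ha : a ≠ 0)
    (pa : Pres f a) (k : ℕ) : Pres f (((2 / n) ^ k) ^ 2 * a) := by
  have hn0 := natC hn
  induction k with
  | zero => simpa using pa
  | succ k ih =>
    have := pres_small hn (mul_ne_zero (pow_ne_zero 2 (pow_ne_zero k (div_ne_zero two_ne_zero hn0))) ha) ih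
    convert this using 1
    ring

lemma mid_ge3 {n : ℕ} (hn : 3 ≤ n) {f : (Fin n → ℂ) → (Fin n → ℂ)} (hf : Continuous f)
    {a : ℂ} (ha : a ≠ 0) (pa : Pres f a) (x v : Fin n → ℂ) (hv : v ⬝ᵥ v = a) :
    f (x + v) + f (x - v) = (2 : ℂ) • f x := by
  have hn2 : 2 ≤ n := by omega
  have hn0 := natC hn2
  obtain ⟨r, hr1, -, hr3⟩ := exists_frame hn2 v (by rw [hv]; exact ha)
  obtain ⟨γ, hγ⟩ := exists_sq (a / 2)
  let δ : ℕ → ℝ := fun k => (2 / n : ℝ) ^ k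
  have hnr : (0 : ℝ) < n := by positivity
  have hn3 : (3 : ℝ) ≤ n := by exact_mod_cast hn
  have hδ : Filter.Tendsto δ Filter.atTop (nhds 0) := by
    apply tendsto_pow_atTop_nhds_zero_of_lt_one (by positivity)
    rw [div_lt_one hnr]; linarith
  have hδ1 : ∀ k, δ k ≤ 1 := fun k => pow_le_one₀ (by positivity) (by rw [div_le_one hnr]; linarith)
  have hδ0 : ∀ k, 0 < δ k := fun k => by positivity
  let s : ℝ → ℝ := fun t => Real.sqrt (1 - t ^ 2 / 2 * (1 - 1 / n))
  have hpos : ∀ k, 0 < 1 - δ k ^ 2 / 2 * (1 - 1 / n) := by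
    intro k
    have h1 : δ k ^ 2 ≤ 1 := pow_le_one₀ (hδ0 k).le (hδ1 k)
    have h2 : (0 : ℝ) < 1 / n := by positivity
    have h3 : (1 : ℝ) / n ≤ 1 := by rw [div_le_one hnr]; linarith
    nlinarith [sq_nonneg (δ k)]
  have key : ∀ k, f (x + ((s (δ k) : ℝ) : ℂ) • v) + f (x - ((s (δ k) : ℝ) : ℂ) • v)
      = (2 / (n : ℂ)) • ∑ i, f (x + (((δ k : ℝ) : ℂ) * γ) • r i) := by
    intro k
    have hs2 : ((s (δ k) : ℝ) : ℂ) ^ 2 = 1 - (δ k : ℂ) ^ 2 / 2 * (1 - 1 / n) := by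
      have := Real.sq_sqrt (hpos k).le
      have h2 : (s (δ k)) ^ 2 = 1 - (δ k) ^ 2 / 2 * (1 - 1 / n) := this
      rw [← Complex.ofReal_pow, h2]
      push_cast
      rfl
    have hs0 : ((s (δ k) : ℝ) : ℂ) ≠ 0 := by
      exact_mod_cast (Real.sqrt_pos.mpr (hpos k)).ne'
    have hdc : ((δ k : ℝ) : ℂ) ≠ 0 := by exact_mod_cast (hδ0 k).ne'
    have pc : Pres f ((δ k : ℂ) ^ 2 * a) := by
      have := pres_small_pow hn2 ha pa k
      convert this using 3
      simp [δ]
    refine (reflect_f hn2 (mul_ne_zero (pow_ne_zero 2 hdc) ha) pc pa x _ _ r ?_ hr3 ?_ ?_ ?_).1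
    · intro i; rw [dotProduct_smul, hr1, smul_zero]
    · rw [mul_pow, hγ]; ring
    · rw [smul_self_dot, hv, hs2]; ring
    · apply inj hn2 ha pa
      have : x + ((s (δ k) : ℝ) : ℂ) • v - (x - ((s (δ k) : ℝ) : ℂ) • v)
          = (2 * ((s (δ k) : ℝ) : ℂ)) • v := by
        ext i; simp; ring
      rw [this, smul_self_dot, hv]
      exact mul_ne_zero (pow_ne_zero 2 (mul_ne_zero two_ne_zero hs0)) ha
  have hsc : Continuous s := by fun_prop
  let F : ℝ → (Fin n → ℂ) := fun t => f (x + ((s t : ℝ) : ℂ) • v) + f (x - ((s t : ℝ) : ℂ) • v)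
  let G : ℝ → (Fin n → ℂ) := fun t => (2 / (n : ℂ)) • ∑ i, f (x + ((t : ℂ) * γ) • r i)
  have hF : Continuous F := by fun_prop
  have hG : Continuous G := by fun_prop
  have h1 : Filter.Tendsto (fun k => F (δ k)) Filter.atTop (nhds (F 0)) := (hF.tendsto 0).comp hδ
  have h2 : Filter.Tendsto (fun k => G (δ k)) Filter.atTop (nhds (G 0)) := (hG.tendsto 0).comp hδ
  have h3 : (fun k => F (δ k)) = fun k => G (δ k) := funext key
  rw [h3] at h1
  have h4 : F 0 = G 0 := tendsto_nhds_unique h1 h2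
  have hs0 : s 0 = 1 := by simp [s]
  simp only [F, G, hs0, Complex.ofReal_one, one_smul, Complex.ofReal_zero, zero_mul, zero_smul,
    add_zero, Finset.sum_const, Finset.card_univ, Fintype.card_fin] at h4
  rw [h4, ← Nat.cast_smul_eq_nsmul ℂ, smul_smul, div_mul_cancel₀ _ hn0]

lemma mid_2 {f : (Fin 2 → ℂ) → (Fin 2 → ℂ)}
    {a : ℂ} (ha : a ≠ 0) (pa : Pres f a) (x v : Fin 2 → ℂ) (hv : v ⬝ᵥ v = a) :
    f (x + v) + f (x - v) = (2 : ℂ) • f x := by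
  have rh : ∀ y u w : Fin 2 → ℂ, u ⬝ᵥ u = a → w ⬝ᵥ w = a → (u - w) ⬝ᵥ (u - w) = a →
      f (y + u + w) + f y = f (y + u) + f (y + w) := by
    intro y u w hu hw huw
    have hne : f (y + u + w) ≠ f y := by
      apply inj le_rfl ha pa
      have : y + u + w - y = u + w := by abel
      rw [this]
      have : (u + w) ⬝ᵥ (u + w) = 3 * a := by
        simp only [add_dotProduct, dotProduct_add, sub_dotProduct, dotProduct_sub] at huw ⊢
        linear_combination 2 * hu + 2 * hw - huw
      rw [this]
      exact mul_ne_zero (by norm_num) ha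
    have := (simplex_reflect le_rfl ![f (y + u), f (y + w)] a a ha ?_ _ _ ?_ ?_ hne).1
    · rw [this]; simp
    · intro i j hij
      fin_cases i <;> fin_cases j
      · exact absurd rfl hij
      · change (f (y + u) - f (y + w)) ⬝ᵥ (f (y + u) - f (y + w)) = a
        apply pa; rw [← huw]; congr 1 <;> abel
      · change (f (y + w) - f (y + u)) ⬝ᵥ (f (y + w) - f (y + u)) = a
        apply pa; rw [← huw, ← neg_dotProduct_neg]; congr 1 <;> abel
      · exact absurd rfl hij
    · intro i
      fin_cases i
      · change (f (y + u + w) - f (y + u)) ⬝ᵥ (f (y + u + w) - f (y + u)) = a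
        apply pa; rw [← hw]; congr 1 <;> abel
      · change (f (y + u + w) - f (y + w)) ⬝ᵥ (f (y + u + w) - f (y + w)) = a
        apply pa; rw [← hu]; congr 1 <;> abel
    · intro i
      fin_cases i
      · change (f y - f (y + u)) ⬝ᵥ (f y - f (y + u)) = a
        apply pa; rw [← hu, ← neg_dotProduct_neg]; congr 1 <;> abel
      · change (f y - f (y + w)) ⬝ᵥ (f y - f (y + w)) = a
        apply pa; rw [← hw, ← neg_dotProduct_neg]; congr 1 <;> abel
  obtain ⟨u, hu, huv⟩ := exists_third le_rfl v (by rw [hv]; exact ha) a a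
  have h1 := rh (x - v) u v hu hv huv
  have h2 := rh (x + u - v) v (v - u) hv (by rw [← huv, ← neg_dotProduct_neg]; congr 1 <;> abel)
    (by rw [← hu]; congr 1 <;> abel)
  have e1 : x - v + u + v = x + u := by abel
  have e2 : x - v + v = x := by abel
  have e3 : x - v + u = x + u - v := by abel
  have e4 : x + u - v + v + (v - u) = x + v := by abel
  have e5 : x + u - v + v = x + u := by abel
  have e6 : x + u - v + (v - u) = x := by abel
  rw [e1, e2, e3] at h1
  rw [e4, e5, e6] at h2
  rw [two_smul]
  have := congrArg₂ (· + ·) h1 h2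
  ext i
  have := congrFun this i
  simp only [Pi.add_apply] at this ⊢
  linear_combination this

lemma mid {n : ℕ} (hn : 2 ≤ n) {f : (Fin n → ℂ) → (Fin n → ℂ)} (hf : Continuous f)
    {a : ℂ} (ha : a ≠ 0) (pa : Pres f a) (x v : Fin n → ℂ) (hv : v ⬝ᵥ v = a) :
    f (x + v) + f (x - v) = (2 : ℂ) • f x := by
  rcases Nat.lt_or_ge 2 n with h | h
  · exact mid_ge3 h hf ha pa x v hv
  · obtain rfl : n = 2 := le_antisymm h hn
    exact mid_2 ha pa x v hv

lemma ap {n : ℕ} (hn : 2 ≤ n) {f : (Fin n → ℂ) → (Fin n → ℂ)} (hf : Continuous f)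
    {a : ℂ} (ha : a ≠ 0) (pa : Pres f a) (x v : Fin n → ℂ) (hv : v ⬝ᵥ v = a) (k : ℕ) :
    f (x + (k : ℂ) • v) = f x + (k : ℂ) • (f (x + v) - f x) := by
  induction k using Nat.strong_induction_on with
  | _ k ih =>
    match k, ih with
    | 0, _ => simp
    | 1, _ => simp
    | k + 2, ih =>
      have h1 := ih (k + 1) (by omega)
      have h0 := ih k (by omega)
      have hm := mid hn hf ha pa (x + ((k + 1 : ℕ) : ℂ) • v) v hv
      have e1 : x + ((k + 1 : ℕ) : ℂ) • v + v = x + ((k + 2 : ℕ) : ℂ) • v := by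
        ext i; simp; ring
      have e2 : x + ((k + 1 : ℕ) : ℂ) • v - v = x + ((k : ℕ) : ℂ) • v := by
        ext i; simp; ring
      rw [e1, e2, h1, h0] at hm
      ext i
      have := congrFun hm i
      simp at this ⊢
      linear_combination this

lemma pres_nat {n : ℕ} (hn : 2 ≤ n) {f : (Fin n → ℂ) → (Fin n → ℂ)} (hf : Continuous f)
    {a : ℂ} (ha : a ≠ 0) (pa : Pres f a) (m : ℕ) (hm : m ≠ 0) : Pres f ((m : ℂ) ^ 2 * a) := by
  intro X Y h
  have hm0 : (m : ℂ) ≠ 0 := by exact_mod_cast hm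
  set v : Fin n → ℂ := (1 / (m : ℂ)) • (X - Y) with hv
  have hvv : v ⬝ᵥ v = a := by rw [hv, smul_self_dot, h]; field_simp
  have hX : X = Y + (m : ℂ) • v := by
    rw [hv, smul_smul, mul_one_div_cancel hm0, one_smul]; abel
  have := ap hn hf ha pa Y v hvv m
  rw [← hX] at this
  rw [this, add_sub_cancel_left, smul_self_dot, pa _ _ (by rw [add_sub_cancel_left, hvv])]

lemma pres_rat {n : ℕ} (hn : 2 ≤ n) {f : (Fin n → ℂ) → (Fin n → ℂ)} (hf : Continuous f)
    {a : ℂ} (ha : a ≠ 0) (pa : Pres f a) (m N : ℕ) (hm : m ≠ 0) (hN : N ≠ 0) :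
    Pres f (((m : ℂ) / N) ^ 2 * a) := by
  intro A B h
  have hm0 : (m : ℂ) ≠ 0 := by exact_mod_cast hm
  have hN0 : (N : ℂ) ≠ 0 := by exact_mod_cast hN
  obtain ⟨O, h1, h2⟩ := third hn A B (by rw [h]; positivity) a a
  have k1 := ap hn hf ha pa O (A - O) h1 N
  have k2 := ap hn hf ha pa O (B - O) h2 N
  have k3 := pres_nat hn hf ha pa m hm (O + (N : ℂ) • (A - O)) (O + (N : ℂ) • (B - O)) (by
    have : O + (N : ℂ) • (A - O) - (O + (N : ℂ) • (B - O)) = (N : ℂ) • (A - B) := by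
      ext i; simp; ring
    rw [this, smul_self_dot, h]; field_simp)
  rw [k1, k2] at k3
  have : f O + (N : ℂ) • (f (O + (A - O)) - f O) - (f O + (N : ℂ) • (f (O + (B - O)) - f O))
      = (N : ℂ) • (f A - f B) := by
    rw [add_sub_cancel, add_sub_cancel]
    ext i; simp; ring
  rw [this, smul_self_dot] at k3
  field_simp
  linear_combination k3

lemma pres_real {n : ℕ} (hn : 2 ≤ n) {f : (Fin n → ℂ) → (Fin n → ℂ)} (hf : Continuous f)
    {a : ℂ} (ha : a ≠ 0) (pa : Pres f a) (t : ℝ) (ht : 0 < t) :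
    Pres f ((t : ℂ) * a) := by
  intro X Y h
  set ρ := Real.sqrt t with hρ
  have hρ0 : (ρ : ℂ) ≠ 0 := by exact_mod_cast (Real.sqrt_pos.mpr ht).ne'
  have hρ2 : (ρ : ℂ) ^ 2 = t := by exact_mod_cast Real.sq_sqrt ht.le
  set v : Fin n → ℂ := (1 / (ρ : ℂ)) • (X - Y) with hv
  have hvv : v ⬝ᵥ v = a := by rw [hv, smul_self_dot, h, ← hρ2]; field_simp
  have hX : X = Y + (ρ : ℂ) • v := by
    rw [hv, smul_smul, mul_one_div_cancel hρ0, one_smul]; abel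
  let F : ℝ → ℂ := fun s => (f (Y + (s : ℂ) • v) - f Y) ⬝ᵥ (f (Y + (s : ℂ) • v) - f Y)
  let G : ℝ → ℂ := fun s => (s : ℂ) ^ 2 * a
  have hF : Continuous F := by
    simp only [F, dotProduct]
    fun_prop
  have hG : Continuous G := by fun_prop
  have hFG : F = G := by
    apply (Rat.denseRange_cast (𝕜 := ℝ)).equalizer hF hG
    funext q
    simp only [Function.comp, F, G]
    by_cases hq : q = 0
    · simp [hq]
    have := pres_rat hn hf ha pa q.num.natAbs q.den (by simpa using hq) q.den_nz
    have hq2 : ((q.num.natAbs : ℂ) / q.den) ^ 2 = ((q : ℝ) : ℂ) ^ 2 := by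
      rw [div_pow, Complex.ofReal_ratCast]
      conv_rhs => rw [Rat.cast_def, div_pow]
      congr 1
      have : (q.num.natAbs : ℤ) ^ 2 = q.num ^ 2 := Int.natAbs_sq _
      have h2 := congrArg (fun z : ℤ => (z : ℂ)) this
      push_cast at h2
      simpa using h2
    rw [hq2] at this
    apply this
    rw [add_sub_cancel_left, smul_self_dot, hvv]
  have := congrFun hFG ρ
  simp only [F, G, ← hX, hρ2] at this
  exact this

end BQ

namespace BQ

def cR {n : ℕ} (w : Fin n → ℝ) : Fin n → ℂ := fun i => (w i : ℂ)

lemma cR_dot {n : ℕ} (w z : Fin n → ℝ) : cR w ⬝ᵥ cR z = ((w ⬝ᵥ z : ℝ) : ℂ) := by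
  simp [cR, dotProduct]

lemma cR_add {n : ℕ} (w z : Fin n → ℝ) : cR (w + z) = cR w + cR z := by
  ext i; simp [cR]

lemma cR_sub {n : ℕ} (w z : Fin n → ℝ) : cR (w - z) = cR w - cR z := by
  ext i; simp [cR]

lemma cR_smul {n : ℕ} (t : ℝ) (w : Fin n → ℝ) : cR (t • w) = (t : ℂ) • cR w := by
  ext i; simp [cR]

lemma rdot_pos {n : ℕ} (w : Fin n → ℝ) (h : w ≠ 0) : 0 < w ⬝ᵥ w := by
  have h1 : 0 ≤ w ⬝ᵥ w := Finset.sum_nonneg fun i _ => mul_self_nonneg _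
  have h2 : w ⬝ᵥ w ≠ 0 := fun h2 => h (dotProduct_self_eq_zero.mp h2)
  exact lt_of_le_of_ne h1 h2.symm

lemma exists_perp {n : ℕ} (hn : 2 ≤ n) (b : Fin n → ℝ) : ∃ w : Fin n → ℝ, w ≠ 0 ∧ b ⬝ᵥ w = 0 := by
  let i0 : Fin n := ⟨0, by omega⟩
  let i1 : Fin n := ⟨1, by omega⟩
  have h01 : i0 ≠ i1 := by simp [i0, i1]
  by_cases h : b i0 = 0
  · exact ⟨Pi.single i0 1, by simp, by simp [h]⟩
  · refine ⟨b i1 • Pi.single i0 1 - b i0 • Pi.single i1 1, ?_, ?_⟩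
    · intro h2
      have := congrFun h2 i1
      simp [h01.symm] at this
      exact h this
    · simp [dotProduct_sub]
      ring

lemma real_pin {n : ℕ} (hn : 2 ≤ n) (b : Fin n → ℝ) (Z : Fin n → ℂ) (η : ℂ) (hη : η.im ≠ 0)
    (H : ∀ w : Fin n → ℝ, ∀ t : ℝ, 0 < t →
      ((Complex.I • cR b - cR w) ⬝ᵥ (Complex.I • cR b - cR w) = t ∨
       (Complex.I • cR b - cR w) ⬝ᵥ (Complex.I • cR b - cR w) = t * η) →
      (Z - cR w) ⬝ᵥ (Z - cR w) = (Complex.I • cR b - cR w) ⬝ᵥ (Complex.I • cR b - cR w)) :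
    Z = Complex.I • cR b := by
  set U := Z - Complex.I • cR b with hU
  have hexp : ∀ w : Fin n → ℝ, (Complex.I • cR b - cR w) ⬝ᵥ (Complex.I • cR b - cR w)
      = ((w ⬝ᵥ w - b ⬝ᵥ b : ℝ) : ℂ) - 2 * ((b ⬝ᵥ w : ℝ) : ℂ) * Complex.I := by
    intro w
    simp only [sub_dotProduct, dotProduct_sub, smul_dotProduct, dotProduct_smul, cR_dot,
      smul_eq_mul, dotProduct_comm w b]
    push_cast
    linear_combination ((b ⬝ᵥ b : ℝ) : ℂ) * Complex.I_mul_I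
  set K := Z ⬝ᵥ Z + ((b ⬝ᵥ b : ℝ) : ℂ) with hK
  have hdiff : ∀ w : Fin n → ℝ, (Z - cR w) ⬝ᵥ (Z - cR w) =
      (Complex.I • cR b - cR w) ⬝ᵥ (Complex.I • cR b - cR w) → K = 2 * (U ⬝ᵥ cR w) := by
    intro w h
    rw [hexp] at h
    simp only [hU, hK, sub_dotProduct, dotProduct_sub, smul_dotProduct, cR_dot, smul_eq_mul,
      dotProduct_comm (cR w) Z] at h ⊢
    push_cast at h
    linear_combination h
  -- the hyperplane orthogonal to b
  have hbig : ∀ w : Fin n → ℝ, b ⬝ᵥ w = 0 → b ⬝ᵥ b < w ⬝ᵥ w → K = 2 * (U ⬝ᵥ cR w) := by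
    intro w h1 h2
    apply hdiff
    apply H w (w ⬝ᵥ w - b ⬝ᵥ b) (by linarith)
    left
    rw [hexp, h1]; simp
  have hbb : 0 ≤ b ⬝ᵥ b := Finset.sum_nonneg fun i _ => mul_self_nonneg _
  have hperp : ∀ w : Fin n → ℝ, b ⬝ᵥ w = 0 → w ≠ 0 → K = 0 ∧ U ⬝ᵥ cR w = 0 := by
    intro w h1 h2
    have hw := rdot_pos w h2
    obtain ⟨N, hN⟩ := exists_nat_gt (b ⬝ᵥ b / (w ⬝ᵥ w))
    have hN1 : b ⬝ᵥ b < N * (w ⬝ᵥ w) := by rwa [div_lt_iff₀ hw] at hN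
    set s : ℝ := N + 1 with hs
    have hNs : (N : ℝ) ≤ s ^ 2 := by
      have : (0 : ℝ) ≤ N := Nat.cast_nonneg N
      nlinarith
    have hs0 : (s : ℂ) ≠ 0 := by
      have : s ≠ 0 := by positivity
      exact_mod_cast this
    have hlt : b ⬝ᵥ b < s ^ 2 * (w ⬝ᵥ w) := by nlinarith
    have e1 := hbig (s • w) (by simp [h1]) (by
      simp only [smul_dotProduct, dotProduct_smul, smul_eq_mul]; linarith)
    have e2 := hbig ((-s) • w) (by simp [h1]) (by
      simp only [smul_dotProduct, dotProduct_smul, smul_eq_mul]; linarith)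
    rw [cR_smul, dotProduct_smul, smul_eq_mul] at e1 e2
    push_cast at e2
    have hK0 : K = 0 := by linear_combination (e1 + e2) / 2
    refine ⟨hK0, ?_⟩
    rw [hK0] at e1
    have : (s : ℂ) * (U ⬝ᵥ cR w) = 0 := by linear_combination -e1 / 2
    exact (mul_eq_zero.mp this).resolve_left hs0
  have hperp' : ∀ w : Fin n → ℝ, b ⬝ᵥ w = 0 → U ⬝ᵥ cR w = 0 := by
    intro w h
    by_cases h2 : w = 0
    · subst h2
      have : cR (0 : Fin n → ℝ) = 0 := by ext i; simp [cR]
      rw [this, dotProduct_zero]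
    · exact (hperp w h h2).2
  obtain ⟨w₀, hw0, hbw0⟩ := exists_perp hn b
  have hK0 := (hperp w₀ hbw0 hw0).1
  have hUb : U ⬝ᵥ cR b = 0 := by
    by_cases hb : b = 0
    · apply hperp'; simp [hb]
    have hs := rdot_pos b hb
    have hw := rdot_pos w₀ hw0
    set S := b ⬝ᵥ b with hS
    set x := ‖η‖ with hx
    have hx0 : 0 ≤ x := norm_nonneg η
    have hre := Complex.abs_re_le_norm η
    have him := Complex.abs_im_le_norm η
    rw [← hx] at hre him
    set t : ℝ := S / (2 * (1 + x)) with ht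
    have ht0 : 0 < t := by positivity
    have htx : t * (1 + x) = S / 2 := by rw [ht]; field_simp
    set α : ℝ := -(t * η.im) / (2 * S) with hα
    have hαS : 2 * (α * S) = -(t * η.im) := by rw [hα]; field_simp
    have hα0 : (α : ℂ) ≠ 0 := by
      have : α ≠ 0 := by
        rw [hα]
        exact div_ne_zero (neg_ne_zero.mpr (mul_ne_zero ht0.ne' hη)) (by positivity)
      exact_mod_cast this
    have hnn : 0 ≤ t * η.re + S - α ^ 2 * S := by
      have h1 : -(S / 2) ≤ t * η.re := by
        have := (abs_le.mp hre).1
        nlinarith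
      have h2 : |t * η.im| ≤ S / 2 := by
        rw [abs_mul, abs_of_pos ht0]; nlinarith
      have h3 : |α| ≤ 1 / 4 := by
        rw [hα, abs_div, abs_neg, abs_of_pos (show 0 < 2 * S by positivity), div_le_iff₀ (by positivity)]
        linarith
      have h4 : α ^ 2 ≤ (1 / 4) ^ 2 := sq_le_sq' (by linarith [(abs_le.mp h3).1]) (abs_le.mp h3).2
      nlinarith
    set β := Real.sqrt ((t * η.re + S - α ^ 2 * S) / (w₀ ⬝ᵥ w₀)) with hβ
    have hβ2 : β ^ 2 * (w₀ ⬝ᵥ w₀) = t * η.re + S - α ^ 2 * S := by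
      rw [hβ, Real.sq_sqrt (by positivity)]; field_simp
    have hw₀b : w₀ ⬝ᵥ b = 0 := by rw [dotProduct_comm]; exact hbw0
    have e := hdiff (α • b + β • w₀) (H _ t ht0 (Or.inr (by
      rw [hexp]
      have h1 : (α • b + β • w₀) ⬝ᵥ (α • b + β • w₀) - S = t * η.re := by
        simp only [add_dotProduct, dotProduct_add, smul_dotProduct, dotProduct_smul, smul_eq_mul,
          hbw0, hw₀b, ← hS]
        linear_combination hβ2
      have h2 : 2 * (b ⬝ᵥ (α • b + β • w₀)) = - (t * η.im) := by
        simp only [dotProduct_add, dotProduct_smul, smul_eq_mul, hbw0, ← hS]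
        linear_combination hαS
      have h2' : 2 * ((b ⬝ᵥ (α • b + β • w₀) : ℝ) : ℂ) = - (t * η.im) := by exact_mod_cast h2
      rw [h1, h2']
      conv_rhs => rw [← Complex.re_add_im η]
      push_cast
      ring)))
    rw [cR_add, cR_smul, cR_smul, dotProduct_add, dotProduct_smul, dotProduct_smul,
      hperp' w₀ hbw0, hK0] at e
    simp only [smul_eq_mul, mul_zero, add_zero] at e
    have : (α : ℂ) * (U ⬝ᵥ cR b) = 0 := by linear_combination -e / 2
    exact (mul_eq_zero.mp this).resolve_left hα0
  have hall : ∀ w : Fin n → ℝ, U ⬝ᵥ cR w = 0 := by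
    intro w
    by_cases hb : b = 0
    · apply hperp'; simp [hb]
    have hs := rdot_pos b hb
    have h1 := hperp' (w - ((b ⬝ᵥ w) / (b ⬝ᵥ b)) • b) (by
      rw [dotProduct_sub, dotProduct_smul, smul_eq_mul, div_mul_cancel₀ _ hs.ne', sub_self])
    rw [cR_sub, cR_smul, dotProduct_sub, dotProduct_smul, hUb, smul_zero, sub_zero] at h1
    exact h1
  have hU0 : U = 0 := by
    ext i
    have h1 := hall (Pi.single i 1)
    have : cR (Pi.single i (1 : ℝ)) = (Pi.single i (1 : ℂ) : Fin n → ℂ) := by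
      ext j; simp only [cR, Pi.single_apply]; split_ifs <;> simp
    rw [this] at h1
    simpa using h1
  exact sub_eq_zero.mp hU0

lemma main {n : ℕ} (hn : 2 ≤ n) {f : (Fin n → ℂ) → (Fin n → ℂ)} (hf : Continuous f) (D d : ℂ)
    (hD : D ≠ 0) (hd : d ≠ 0) (hη : (d ^ 2 / D ^ 2).im ≠ 0)
    (p1 : Pres f (D ^ 2)) (p2 : Pres f (d ^ 2)) :
    ∃ L : (Fin n → ℂ) →ₗ[ℂ] (Fin n → ℂ), (∀ x y, L x ⬝ᵥ L y = x ⬝ᵥ y) ∧ ∀ X, f X = L X + f 0 := by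
  have hD2 : D ^ 2 ≠ 0 := pow_ne_zero 2 hD
  have hd2 : d ^ 2 ≠ 0 := pow_ne_zero 2 hd
  have q1 := pres_real hn hf hD2 p1
  have q2 := pres_real hn hf hd2 p2
  let g : (Fin n → ℝ) → (Fin n → ℂ) := fun x => f (D • cR x) - f 0
  have hc0 : cR (0 : Fin n → ℝ) = 0 := by ext i; simp [cR]
  have hg0 : g 0 = 0 := by simp [g, hc0]
  have hg1 : ∀ x y, (g x - g y) ⬝ᵥ (g x - g y) = D ^ 2 * (((x - y) ⬝ᵥ (x - y) : ℝ) : ℂ) := by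
    intro x y
    by_cases hxy : x = y
    · simp [hxy]
    have h1 : g x - g y = f (D • cR x) - f (D • cR y) := by simp only [g]; abel
    rw [h1, mul_comm]
    apply q1 _ (rdot_pos _ (sub_ne_zero.mpr hxy))
    rw [← smul_sub, ← cR_sub, smul_self_dot, cR_dot, mul_comm]
  have hg2 : ∀ x y, g x ⬝ᵥ g y = D ^ 2 * ((x ⬝ᵥ y : ℝ) : ℂ) := by
    intro x y
    have h1 := hg1 x y
    have h2 := hg1 x 0
    have h3 := hg1 y 0
    rw [hg0] at h2 h3
    simp only [sub_zero] at h2 h3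
    simp only [sub_dotProduct, dotProduct_sub, dotProduct_comm (g y) (g x), dotProduct_comm y x,
      h2, h3] at h1
    push_cast at h1
    linear_combination -h1 / 2
  let b : Fin n → (Fin n → ℂ) := fun i => (1 / D) • g (Pi.single i 1)
  have hb : ∀ i j, b i ⬝ᵥ b j = if i = j then 1 else 0 := by
    intro i j
    simp only [b, smul_dotProduct, dotProduct_smul, hg2, smul_eq_mul]
    rw [single_dotProduct, Pi.single_apply]
    split_ifs <;> field_simp <;> simp
  have hbi : LinearIndependent ℂ b := by
    rw [Fintype.linearIndependent_iff]
    intro c hc j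
    have : (∑ i, c i • b i) ⬝ᵥ b j = 0 := by rw [hc, zero_dotProduct]
    simpa [sum_dotProduct, smul_dotProduct, hb] using this
  let L : (Fin n → ℂ) →ₗ[ℂ] (Fin n → ℂ) := Fintype.linearCombination ℂ b
  have hLb : ∀ x j, L x ⬝ᵥ b j = x j := by
    intro x j
    simp [L, Fintype.linearCombination_apply, sum_dotProduct, smul_dotProduct, hb]
  have hL : ∀ x y, L x ⬝ᵥ L y = x ⬝ᵥ y := by
    intro x y
    have : L y = ∑ i, y i • b i := by simp [L, Fintype.linearCombination_apply]
    rw [this, dotProduct_sum]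
    simp only [dotProduct_smul, hLb, smul_eq_mul]
    simp only [dotProduct]
    exact Finset.sum_congr rfl fun i _ => mul_comm _ _
  have hLinj : Function.Injective L := by
    rw [← LinearMap.ker_eq_bot, LinearMap.ker_eq_bot']
    intro x hx
    ext j
    rw [← hLb x j, hx, zero_dotProduct]; rfl
  have hLsurj : Function.Surjective L := LinearMap.injective_iff_surjective.mp hLinj
  have hreal : ∀ x : Fin n → ℝ, f (D • cR x) = L (D • cR x) + f 0 := by
    intro x
    have h1 : g x - L (D • cR x) = 0 := by
      apply eq_zero_of_perp b hbi
      intro j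
      rw [sub_dotProduct, hLb]
      simp only [b, dotProduct_smul, hg2, smul_eq_mul, Pi.smul_apply, cR]
      rw [dotProduct_single]
      field_simp
      simp
    have h2 := sub_eq_zero.mp h1
    rw [← h2]; simp [g]
  refine ⟨L, hL, fun X => ?_⟩
  obtain ⟨W, hW⟩ := hLsurj (f X - f 0)
  let a : Fin n → ℝ := fun i => (X i / D).re
  let c : Fin n → ℝ := fun i => (X i / D).im
  have hX : X = D • (cR a + Complex.I • cR c) := by
    ext i
    simp only [Pi.smul_apply, Pi.add_apply, cR, smul_eq_mul, a, c]
    rw [mul_comm Complex.I, Complex.re_add_im]; field_simp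
  have hpin := real_pin hn c ((1 / D) • W - cR a) (d ^ 2 / D ^ 2) hη (by
    intro w t ht h
    have e1 : X - D • cR (a + w) = D • (Complex.I • cR c - cR w) := by
      conv_lhs => rw [hX]
      rw [cR_add, ← smul_sub]; congr 1; abel
    have e2 : f X - f (D • cR (a + w)) = L (D • ((1 / D) • W - cR a - cR w)) := by
      rw [hreal, ← sub_sub, sub_right_comm, ← hW, ← map_sub]
      congr 1
      rw [smul_sub, smul_sub, smul_smul, mul_one_div_cancel hD, one_smul, cR_add, smul_add]; abel
    have e3 : (X - D • cR (a + w)) ⬝ᵥ (X - D • cR (a + w)) =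
        D ^ 2 * ((Complex.I • cR c - cR w) ⬝ᵥ (Complex.I • cR c - cR w)) := by
      rw [e1, smul_self_dot]
    have e4 : (f X - f (D • cR (a + w))) ⬝ᵥ (f X - f (D • cR (a + w))) =
        D ^ 2 * (((1 / D) • W - cR a - cR w) ⬝ᵥ ((1 / D) • W - cR a - cR w)) := by
      rw [e2, hL, smul_self_dot]
    apply mul_left_cancel₀ hD2
    rw [← e3, ← e4]
    rcases h with h | h
    · rw [h] at e3
      rw [e3, mul_comm]
      apply q1 t ht
      rw [e3, mul_comm]
    · rw [h] at e3
      have e5 : D ^ 2 * (t * (d ^ 2 / D ^ 2)) = t * d ^ 2 := by field_simp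
      rw [e5] at e3
      rw [e3]
      exact q2 t ht _ _ e3)
  have hWX : W = X := by
    rw [hX, ← hpin, add_sub_cancel, smul_smul, mul_one_div_cancel hD, one_smul]
  rw [hWX] at hW
  rw [hW]; abel

end BQ

theorem stmt_10 (n : ℕ) (hn : 2 ≤ n) (d₁ d₂ : ℂ) (hd₁ : d₁ ≠ 0) (hd₂ : d₂ ≠ 0)
    (hratio : d₁ ^ 2 / d₂ ^ 2 ∉ Set.range ((↑) : ℝ → ℂ))
    (f : (Fin n → ℂ) → (Fin n → ℂ)) (hcont : Continuous f)
    (hf₁ : ∀ X Y : Fin n → ℂ, phi n X Y = d₁ ^ 2 → phi n (f X) (f Y) = d₁ ^ 2)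
    (hf₂ : ∀ X Y : Fin n → ℂ, phi n X Y = d₂ ^ 2 → phi n (f X) (f Y) = d₂ ^ 2) :
    ∃ I : (Fin n → ℂ) →ᵃ[ℂ] (Fin n → ℂ),
      (∀ X Y : Fin n → ℂ, phi n (I X) (I Y) = phi n X Y) ∧
      (∀ X : Fin n → ℂ, f X = I X) := by
  have hphi : ∀ X Y : Fin n → ℂ, phi n X Y = (X - Y) ⬝ᵥ (X - Y) := by
    intro X Y
    simp [phi, dotProduct, sq]
  have hη : (d₁ ^ 2 / d₂ ^ 2).im ≠ 0 := by
    intro h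
    exact hratio ⟨(d₁ ^ 2 / d₂ ^ 2).re, Complex.ext rfl (by simpa using h.symm)⟩
  obtain ⟨L, hL, hLf⟩ := BQ.main hn hcont d₂ d₁ hd₂ hd₁ hη
    (fun X Y h => by rw [← hphi] at h ⊢; exact hf₂ X Y h)
    (fun X Y h => by rw [← hphi] at h ⊢; exact hf₁ X Y h)
  refine ⟨L.toAffineMap + AffineMap.const ℂ _ (f 0), ?_, ?_⟩
  · intro X Y
    rw [hphi, hphi]
    simp [hL]
  · intro X
    rw [hLf X]; simp
end

section
/- For each n ≥ 2, D(ℂⁿ,ℂⁿ) is a dense subset of the interval (0,∞). -/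
/-- D(ℂⁿ,ℂⁿ): the set of all real d > 0 such that for all X, Y ∈ ℂⁿ with
φ_n(X,Y) = d² there is a finite set S_XY with {X,Y} ⊆ S_XY ⊆ ℂⁿ such that every
map from S_XY to ℂⁿ preserving unit distance on S_XY preserves the distance
between X and Y. -/
def DCC (n : ℕ) : Set ℝ :=
  {d | 0 < d ∧ ∀ X Y : Fin n → ℂ, phi n X Y = (d : ℂ) ^ 2 →
    ∃ S : Finset (Fin n → ℂ), X ∈ S ∧ Y ∈ S ∧
      ∀ f : (Fin n → ℂ) → (Fin n → ℂ),
        (∀ P ∈ S, ∀ Q ∈ S, phi n P Q = 1 → phi n (f P) (f Q) = 1) →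
        phi n (f X) (f Y) = (d : ℂ) ^ 2}

/-! ### Abstract real part -/

theorem aux_dense (E : Set ℝ) (hpos : ∀ x ∈ E, 0 < x)
    (hmul : ∀ x ∈ E, ∀ y ∈ E, x * y ∈ E) (h1 : (1 : ℝ) ∈ E)
    (eps : ℝ) (heps : eps ∈ E) (heps1 : eps < 1)
    (hxy : ∀ δ : ℝ, 1 < δ → ∃ x ∈ E, ∃ y ∈ E, 1 < x ∧ x < y ∧ y < δ * x)
    (t δ : ℝ) (ht : 0 < t) (hδ : 1 < δ) : ∃ s ∈ E, s ≤ t ∧ t < δ * s := by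
  have hpow : ∀ x ∈ E, ∀ k : ℕ, x ^ k ∈ E := by
    intro x hx k
    induction k with
    | zero => simpa using h1
    | succ k ih => rw [pow_succ]; exact hmul _ ih _ hx
  obtain ⟨x, hx, y, hy, hx1, hxy1, hyδ⟩ := hxy δ hδ
  have hx0 : 0 < x := hpos x hx
  have he0 := hpos eps heps
  set r := y / x with hr
  have hr1 : 1 < r := by rw [hr, one_lt_div hx0]; exact hxy1
  have hrδ : r < δ := by rw [hr, div_lt_iff₀ hx0]; exact hyδ
  obtain ⟨M1, hM1⟩ := pow_unbounded_of_one_lt (1 / eps) hr1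
  obtain ⟨M2, hM2⟩ := pow_unbounded_of_one_lt t hx1
  set M := max M1 M2
  have hM1' : 1 / eps < r ^ M := lt_of_lt_of_le hM1 (pow_le_pow_right₀ hr1.le (le_max_left _ _))
  have hM2' : t < x ^ M := lt_of_lt_of_le hM2 (pow_le_pow_right₀ hx1.le (le_max_right _ _))
  have hxM : 0 < x ^ M := by positivity
  obtain ⟨j, hj1, hj2⟩ := exists_nat_pow_near_of_lt_one (x := t / x ^ M) (y := eps)
    (by positivity) (by rw [div_le_one hxM]; exact hM2'.le) he0 heps1
  rw [lt_div_iff₀ hxM] at hj1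
  rw [div_le_iff₀ hxM] at hj2
  have hA : 0 < eps ^ (j + 1) * x ^ M := by positivity
  obtain ⟨i, hi1, hi2⟩ := exists_nat_pow_near (x := t / (eps ^ (j + 1) * x ^ M)) (y := r)
    (by rw [le_div_iff₀ hA]; linarith) hr1
  have hle : t / (eps ^ (j + 1) * x ^ M) ≤ 1 / eps := by
    rw [div_le_div_iff₀ hA he0]
    calc t * eps ≤ (eps ^ j * x ^ M) * eps := by gcongr
      _ = 1 * (eps ^ (j + 1) * x ^ M) := by ring
  have hiM : i ≤ M := by
    by_contra hcon
    have : r ^ M ≤ r ^ i := pow_le_pow_right₀ hr1.le (by omega)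
    linarith
  rw [le_div_iff₀ hA] at hi1
  rw [div_lt_iff₀ hA] at hi2
  have key : eps ^ (j + 1) * (x ^ (M - i) * y ^ i) = r ^ i * (eps ^ (j + 1) * x ^ M) := by
    have : x ^ M = x ^ (M - i) * x ^ i := by rw [← pow_add]; congr 1; omega
    rw [this, hr, div_pow]
    field_simp
  refine ⟨eps ^ (j + 1) * (x ^ (M - i) * y ^ i), hmul _ (hpow _ heps _) _
    (hmul _ (hpow _ hx _) _ (hpow _ hy _)), ?_, ?_⟩
  · rw [key]; exact hi1
  · rw [key]
    have : 0 < r ^ i * (eps ^ (j + 1) * x ^ M) := by positivity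
    calc t < r ^ (i + 1) * (eps ^ (j + 1) * x ^ M) := hi2
      _ = r * (r ^ i * (eps ^ (j + 1) * x ^ M)) := by ring
      _ < δ * (r ^ i * (eps ^ (j + 1) * x ^ M)) := by gcongr

theorem aux_dense2 (E : Set ℝ) (κ : ℝ) (hκ0 : 0 ≤ κ) (hκ : κ < 1 / 2) (hpos : ∀ x ∈ E, 0 < x)
    (hmul : ∀ x ∈ E, ∀ y ∈ E, x * y ∈ E) (h1 : (1 : ℝ) ∈ E)
    (hkite : ∀ b ∈ E, ∀ p ∈ E, ∀ x ∈ E, ∀ c ∈ E, p - κ * b ≠ 0 →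
      0 < 4 * c - (c + p - x) ^ 2 / (p - κ * b) → 4 * c - (c + p - x) ^ 2 / (p - κ * b) ∈ E)
    (t δ : ℝ) (ht : 0 < t) (hδ : 1 < δ) : ∃ s ∈ E, s ≤ t ∧ t < δ * s := by
  have hpow : ∀ x ∈ E, ∀ k : ℕ, x ^ k ∈ E := by
    intro x hx k
    induction k with
    | zero => simpa using h1
    | succ k ih => rw [pow_succ]; exact hmul _ ih _ hx
  have hq0 : 0 < 1 - κ := by linarith
  have hreg : ∀ a ∈ E, ∀ b ∈ E, 0 < 4 * a - b / (1 - κ) → 4 * a - b / (1 - κ) ∈ E := by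
    intro a ha b hb h
    have hb0 := hpos b hb
    have h2 : b - κ * b ≠ 0 := by nlinarith
    have h3 : 4 * a - (a + b - a) ^ 2 / (b - κ * b) = 4 * a - b / (1 - κ) := by
      have : b - κ * b = b * (1 - κ) := by ring
      rw [this]; field_simp; ring
    have := hkite b hb b hb a ha a ha h2
    rw [h3] at this
    exact this h
  have hq2 : 1 / (1 - κ) < 2 := by rw [div_lt_iff₀ hq0]; linarith
  have hq1 : 0 < 1 / (1 - κ) := by positivity
  obtain ⟨l, hl, hl2⟩ : ∃ l ∈ E, 2 < l :=
    ⟨4 * 1 - 1 / (1 - κ), hreg 1 h1 1 h1 (by linarith), by linarith⟩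
  -- small elements
  have hsmall : ∀ k : ℕ, 1 ≤ k → (1 - 2 * κ) ^ 2 / ((1 - κ) * (l ^ k - κ)) ∈ E := by
    intro k hk
    have hlk : 2 < l ^ k := lt_of_lt_of_le hl2 (le_self_pow₀ (by linarith) (by omega))
    have hd : 0 < l ^ k - κ := by linarith
    have hB : 0 < 4 * (1 - κ) - (1 - 2 * κ) ^ 2 / (l ^ k - κ) := by
      have : (1 - 2 * κ) ^ 2 / (l ^ k - κ) < 1 := by
        rw [div_lt_one hd]; nlinarith
      linarith
    have heq : 4 * (l ^ k) - (l ^ k + l ^ k - 1) ^ 2 / (l ^ k - κ * 1)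
        = 4 * (1 - κ) - (1 - 2 * κ) ^ 2 / (l ^ k - κ) := by
      rw [mul_one]; field_simp; ring
    have hy := hkite 1 h1 (l ^ k) (hpow l hl k) 1 h1 (l ^ k) (hpow l hl k)
      (by rw [mul_one]; exact hd.ne') (by rw [heq]; exact hB)
    rw [heq] at hy
    have heq2 : 4 * 1 - (4 * (1 - κ) - (1 - 2 * κ) ^ 2 / (l ^ k - κ)) / (1 - κ)
        = (1 - 2 * κ) ^ 2 / ((1 - κ) * (l ^ k - κ)) := by
      field_simp; ring
    have := hreg 1 h1 _ hy
    rw [heq2] at this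
    apply this
    have : 0 < 1 - 2 * κ := by linarith
    positivity
  have hsmall2 : ∀ η : ℝ, 0 < η → ∃ e ∈ E, e < η := by
    intro η hη
    obtain ⟨k, hk⟩ := pow_unbounded_of_one_lt (2 / η + 1) (show 1 < l by linarith)
    have hlk : l ^ k ≤ l ^ (k + 1) := pow_le_pow_right₀ (by linarith) (by omega)
    refine ⟨_, hsmall (k + 1) (by omega), ?_⟩
    have hη2 : 0 < 2 / η := by positivity
    have hd : 0 < l ^ (k + 1) - κ := by linarith
    rw [div_lt_iff₀ (by positivity)]
    have h4 : 2 / η < l ^ (k + 1) - κ := by linarith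
    rw [div_lt_iff₀ hη] at h4
    have h5 : (1 - 2 * κ) ^ 2 ≤ 1 := by nlinarith
    nlinarith
  obtain ⟨eps, heps, heps1⟩ := hsmall2 1 one_pos
  refine aux_dense E hpos hmul h1 eps heps heps1 ?_ t δ ht hδ
  intro δ hδ
  obtain ⟨e, he, he1⟩ := hsmall2 (min 1 (2 - 2 / δ)) (by
    apply lt_min one_pos
    have : 2 / δ < 2 := by rw [div_lt_iff₀ (by linarith)]; linarith
    linarith)
  obtain ⟨e', he', he1'⟩ := hsmall2 e (hpos e he)
  have hea := lt_of_lt_of_le he1 (min_le_left _ _)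
  have heb := lt_of_lt_of_le he1 (min_le_right _ _)
  have hep := hpos e he
  have hep' := hpos e' he'
  have hqe : e / (1 - κ) < 2 * e := by
    rw [div_lt_iff₀ hq0]; nlinarith
  have hqe' : e' / (1 - κ) < e / (1 - κ) := by gcongr
  have hqe0 : 0 < e' / (1 - κ) := by positivity
  refine ⟨_, hreg 1 h1 e he (by linarith), _, hreg 1 h1 e' he' (by linarith), by linarith,
    by linarith, ?_⟩
  have h6 : e / (1 - κ) < 4 - 4 / δ := by
    have : 4 / δ = 2 * (2 / δ) := by ring
    linarith
  have h7 : 4 = δ * (4 / δ) := by field_simp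
  nlinarith

/-! ### Geometry -/

/-- unit distance preservation on a finite set -/
def Pres (n : ℕ) (S : Finset (Fin n → ℂ)) (f : (Fin n → ℂ) → (Fin n → ℂ)) : Prop :=
  ∀ P ∈ S, ∀ Q ∈ S, phi n P Q = 1 → phi n (f P) (f Q) = 1

/-- the squared distance `t` is determined by finitely many unit distances -/
def Det (n : ℕ) (t : ℂ) : Prop :=
  ∀ X Y : Fin n → ℂ, phi n X Y = t → ∃ S : Finset (Fin n → ℂ),
    ∀ f : (Fin n → ℂ) → (Fin n → ℂ), Pres n S f → phi n (f X) (f Y) = t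

theorem Pres.mono {n : ℕ} {S T : Finset (Fin n → ℂ)} {f} (h : Pres n T f) (hST : S ⊆ T) :
    Pres n S f := fun P hP Q hQ => h P (hST hP) Q (hST hQ)

theorem phi_eq_dot (n : ℕ) (X Y : Fin n → ℂ) : phi n X Y = (X - Y) ⬝ᵥ (X - Y) := by
  simp [phi, dotProduct, sq]

theorem big (n : ℕ) (T : Finset (Fin n → ℂ)) : ∃ S : Finset (Fin n → ℂ),
    ∀ f, Pres n S f → ∀ P ∈ T, ∀ Q ∈ T, Det n (phi n P Q) → phi n (f P) (f Q) = phi n P Q := by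
  classical
  have h : ∀ P Q : Fin n → ℂ, ∃ S : Finset (Fin n → ℂ), ∀ f, Pres n S f →
      Det n (phi n P Q) → phi n (f P) (f Q) = phi n P Q := by
    intro P Q
    by_cases hd : Det n (phi n P Q)
    · obtain ⟨S, hS⟩ := hd P Q rfl
      exact ⟨S, fun f hf _ => hS f hf⟩
    · exact ⟨∅, fun f _ h => absurd h hd⟩
  choose S hS using h
  refine ⟨T.biUnion fun P => T.biUnion fun Q => S P Q, ?_⟩
  intro f hf P hP Q hQ hd
  refine hS P Q f (hf.mono ?_) hd
  intro z hz
  simp only [Finset.mem_biUnion]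
  exact ⟨P, hP, Q, hQ, hz⟩

theorem det_one (n : ℕ) : Det n 1 := by
  classical
  intro X Y h
  refine ⟨{X, Y}, fun f hf => hf X (by simp) Y (by simp) h⟩

theorem phi_smul (n : ℕ) (r : ℂ) (X Y : Fin n → ℂ) :
    phi n (r • X) (r • Y) = r ^ 2 * phi n X Y := by
  simp only [phi, Finset.mul_sum, Pi.smul_apply, smul_eq_mul]
  exact Finset.sum_congr rfl fun i _ => by ring

theorem det_mul (n : ℕ) (a b : ℂ) (ha0 : a ≠ 0) (ha : Det n a) (hb : Det n b) :
    Det n (a * b) := by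
  classical
  intro X Y hXY
  obtain ⟨r, hr⟩ := IsAlgClosed.exists_pow_nat_eq a (n := 2) (by norm_num)
  have hr0 : r ≠ 0 := by rintro rfl; apply ha0; rw [← hr]; simp
  obtain ⟨S, hS⟩ := hb (r⁻¹ • X) (r⁻¹ • Y) (by
    rw [phi_smul, hXY, ← hr]; field_simp)
  obtain ⟨S', hS'⟩ := big n (S.image fun z => r • z)
  refine ⟨S', fun f hf => ?_⟩
  have := hS (fun z => r⁻¹ • f (r • z)) (by
    intro P hP Q hQ hPQ
    have h1 : phi n (r • P) (r • Q) = a := by rw [phi_smul, hPQ, hr, mul_one]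
    have h2 := hS' f hf (r • P) (Finset.mem_image_of_mem _ hP) (r • Q)
      (Finset.mem_image_of_mem _ hQ) (by rw [h1]; exact ha)
    show phi n (r⁻¹ • f (r • P)) (r⁻¹ • f (r • Q)) = 1
    rw [phi_smul, h2, h1, ← hr]; field_simp)
  simp only [phi_smul, smul_inv_smul₀ hr0] at this
  rw [← this, ← hr]
  field_simp

/-- reflections -/
theorem exists_isom_aux (n : ℕ) (v w : Fin n → ℂ) (hvw : v ⬝ᵥ v = w ⬝ᵥ w) (hv : v ⬝ᵥ v ≠ 0) :
    ∃ g : (Fin n → ℂ) → (Fin n → ℂ), (∀ x y, (g x - g y) ⬝ᵥ (g x - g y) = (x - y) ⬝ᵥ (x - y)) ∧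
      g 0 = 0 ∧ g v = w := by
  have refl : ∀ w : Fin n → ℂ, v ⬝ᵥ v = w ⬝ᵥ w → (v - w) ⬝ᵥ (v - w) ≠ 0 →
      ∃ g : (Fin n → ℂ) → (Fin n → ℂ),
        (∀ x y, (g x - g y) ⬝ᵥ (g x - g y) = (x - y) ⬝ᵥ (x - y)) ∧ g 0 = 0 ∧ g v = w := by
    intro w hvw ha
    set a := v - w with had
    refine ⟨fun z => z - (2 * (z ⬝ᵥ a) / (a ⬝ᵥ a)) • a, ?_, by simp, ?_⟩
    · intro x y
      have : (x - (2 * (x ⬝ᵥ a) / (a ⬝ᵥ a)) • a) - (y - (2 * (y ⬝ᵥ a) / (a ⬝ᵥ a)) • a)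
          = (x - y) - (2 * ((x - y) ⬝ᵥ a) / (a ⬝ᵥ a)) • a := by
        rw [sub_dotProduct]
        ext i; simp; ring
      simp only [this]
      generalize x - y = z
      simp only [sub_dotProduct, dotProduct_sub, smul_dotProduct, dotProduct_smul, smul_eq_mul]
      rw [dotProduct_comm a z]
      field_simp
      ring
    · have h1 : 2 * (v ⬝ᵥ a) = a ⬝ᵥ a := by
        simp only [had, sub_dotProduct, dotProduct_sub]
        rw [dotProduct_comm w v, ← hvw]; ring
      show v - (2 * (v ⬝ᵥ a) / (a ⬝ᵥ a)) • a = w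
      rw [h1, div_self ha, one_smul, had]; abel
  by_cases h : (v - w) ⬝ᵥ (v - w) = 0
  · have h2 : (v - -w) ⬝ᵥ (v - -w) ≠ 0 := by
      intro h3
      apply hv
      simp only [sub_dotProduct, dotProduct_sub, neg_dotProduct, dotProduct_neg] at h h3
      rw [← hvw] at h h3
      linear_combination (h + h3) / 4
    obtain ⟨g, hg, hg0, hgv⟩ := refl (-w) (by simp [hvw]) h2
    refine ⟨fun z => - g z, ?_, by simp [hg0], by simp [hgv]⟩
    intro x y
    have h4 : - g x - - g y = - (g x - g y) := by ring
    rw [← hg x y]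
    simp only [h4]
    exact neg_dotProduct_neg _ _
  · exact refl w hvw h

theorem exists_isom (n : ℕ) (X Y X₀ Y₀ : Fin n → ℂ) (h : phi n X₀ Y₀ = phi n X Y)
    (h0 : phi n X Y ≠ 0) : ∃ g : (Fin n → ℂ) → (Fin n → ℂ),
      (∀ P Q, phi n (g P) (g Q) = phi n P Q) ∧ g X₀ = X ∧ g Y₀ = Y := by
  simp only [phi_eq_dot] at h h0 ⊢
  obtain ⟨g, hg, hg0, hgv⟩ := exists_isom_aux n (X₀ - Y₀) (X - Y) h (by rw [h]; exact h0)
  refine ⟨fun z => g (z - Y₀) + Y, ?_, by simp [hgv], by simp [hg0]⟩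
  intro P Q
  have := hg (P - Y₀) (Q - Y₀)
  simpa using this

/-- Excluding collapse. -/
theorem det_of_weak (m : ℕ) (e : ℂ) (he : e ≠ 0)
    (hw : ∀ X Y : Fin (m + 2) → ℂ, phi (m + 2) X Y = e → ∃ S : Finset (Fin (m + 2) → ℂ),
      ∀ f, Pres (m + 2) S f → f X = f Y ∨ phi (m + 2) (f X) (f Y) = e) : Det (m + 2) e := by
  classical
  by_cases he1 : e = 1
  · rw [he1]; exact det_one _
  intro X Y hXY
  obtain ⟨r, hr⟩ := IsAlgClosed.exists_pow_nat_eq e (n := 2) (by norm_num)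
  have hr0 : r ≠ 0 := by rintro rfl; apply he; rw [← hr]; simp
  obtain ⟨s, hs⟩ := IsAlgClosed.exists_pow_nat_eq (e - ((2 * e - 1) / (2 * r)) ^ 2) (n := 2)
    (by norm_num)
  obtain ⟨g, hg, hgX, hgY⟩ := exists_isom (m + 2) X Y 0 (Fin.cons r 0)
    (by rw [hXY, ← hr]; simp [phi, Fin.sum_univ_succ]) (by rw [hXY]; exact he)
  set Z₀ : Fin (m + 2) → ℂ := Fin.cons ((2 * e - 1) / (2 * r)) (Fin.cons s 0) with hZ₀
  have hXZ : phi (m + 2) X (g Z₀) = e := by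
    rw [← hgX, hg]
    simp only [phi, hZ₀, Fin.sum_univ_succ]
    simp
    rw [hs]; ring
  have hYZ : phi (m + 2) Y (g Z₀) = 1 := by
    rw [← hgY, hg]
    simp only [phi, hZ₀, Fin.sum_univ_succ]
    simp
    rw [hs, ← hr]; field_simp; ring
  obtain ⟨S1, hS1⟩ := hw X Y hXY
  obtain ⟨S2, hS2⟩ := hw X (g Z₀) hXZ
  refine ⟨S1 ∪ S2 ∪ {Y, g Z₀}, fun f hf => ?_⟩
  have h3 : phi (m + 2) (f Y) (f (g Z₀)) = 1 := hf _ (by simp) _ (by simp) hYZ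
  rcases hS1 f (hf.mono fun z hz => by simp [hz]) with h1 | h1
  · exfalso
    rcases hS2 f (hf.mono fun z hz => by simp [hz]) with h2 | h2
    · rw [← h1, ← h2] at h3
      simp [phi] at h3
    · rw [h1, h3] at h2
      exact he1 h2.symm
  · exact h1

theorem dot_of_phi (n : ℕ) (A B C : Fin n → ℂ) :
    (A - C) ⬝ᵥ (B - C) = (phi n A C + phi n B C - phi n A B) / 2 := by
  simp only [phi_eq_dot, sub_dotProduct, dotProduct_sub]
  rw [dotProduct_comm B A, dotProduct_comm C A, dotProduct_comm C B]
  ring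

/-- Rigidity of the kite. -/
theorem kite_rigid (m : ℕ) (hm : 1 ≤ m) (b p x c κ : ℂ) (hκ : 2 * m * κ = m - 1) (hb : b ≠ 0)
    (hρ : p - κ * b ≠ 0) (Q : Fin m → Fin (m + 1) → ℂ) (P X Y : Fin (m + 1) → ℂ)
    (hQQ : ∀ i j, i ≠ j → phi (m + 1) (Q i) (Q j) = b)
    (hQP : ∀ i, phi (m + 1) (Q i) P = p)
    (hXQ : ∀ i, phi (m + 1) X (Q i) = x) (hYQ : ∀ i, phi (m + 1) Y (Q i) = x)
    (hXP : phi (m + 1) X P = c) (hYP : phi (m + 1) Y P = c) :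
    X = Y ∨ phi (m + 1) X Y = 4 * c - (c + p - x) ^ 2 / (p - κ * b) := by
  have hm0 : (m : ℂ) ≠ 0 := by exact_mod_cast (by omega : m ≠ 0)
  set w : Fin m → Fin (m + 1) → ℂ := fun i => Q i - P with hw
  have hww : ∀ i j, w i ⬝ᵥ w j = (p - b / 2) + if i = j then b / 2 else 0 := by
    intro i j
    rw [hw, dot_of_phi, hQP, hQP]
    split_ifs with h
    · subst h; simp [phi]
    · rw [hQQ i j h]; ring
  set z := X - P with hz
  set z' := Y - P with hz'
  have hzw : ∀ i, z ⬝ᵥ w i = (c + p - x) / 2 := by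
    intro i; rw [hz, hw, dot_of_phi, hQP, hXP, hXQ]
  have hzw' : ∀ i, z' ⬝ᵥ w i = (c + p - x) / 2 := by
    intro i; rw [hz', hw, dot_of_phi, hQP, hYP, hYQ]
  have hzz : z ⬝ᵥ z = c := by rw [hz, ← phi_eq_dot, hXP]
  have hzz' : z' ⬝ᵥ z' = c := by rw [hz', ← phi_eq_dot, hYP]
  set ρ := p - κ * b with hρd
  set γ := (c + p - x) / 2 / (m * ρ) with hγ
  have hrow : (m : ℂ) * (p - b / 2) + b / 2 = m * ρ := by
    rw [hρd]; linear_combination (b / 2) * hκ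
  set W : Fin (m + 1) → ℂ := γ • ∑ i, w i with hW
  have hWw : ∀ j, W ⬝ᵥ w j = (c + p - x) / 2 := by
    intro j
    rw [hW, smul_dotProduct, sum_dotProduct]
    simp only [hww, Finset.sum_add_distrib]
    simp only [Finset.sum_const, Finset.card_univ, Fintype.card_fin, nsmul_eq_mul,
      Finset.sum_ite_eq', Finset.mem_univ, if_true, smul_eq_mul]
    rw [hrow, hγ]; field_simp
  have hdotW : ∀ y : Fin (m + 1) → ℂ, (∀ i, y ⬝ᵥ w i = (c + p - x) / 2) →
      y ⬝ᵥ W = (c + p - x) ^ 2 / 4 / ρ := by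
    intro y hy
    rw [hW, dotProduct_smul, dotProduct_sum]
    simp only [hy]
    simp only [Finset.sum_const, Finset.card_univ, Fintype.card_fin, nsmul_eq_mul, smul_eq_mul]
    rw [hγ]; field_simp; ring
  have hzW := hdotW z hzw
  have hzW' := hdotW z' hzw'
  have hWW := hdotW W hWw
  -- the two orthogonal vectors
  by_cases hu : z - z' = 0
  · left
    have : X - Y = z - z' := by rw [hz, hz']; abel
    rw [hu] at this
    exact sub_eq_zero.mp this
  right
  have hh : z + z' - (2 : ℂ) • W = 0 := by
    by_contra hh
    set M : Matrix (Fin (m + 1)) (Fin (m + 1)) ℂ := Matrix.of (Fin.cons (z - z') w) with hM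
    have hMh : M.mulVec (z + z' - (2 : ℂ) • W) = 0 := by
      ext i
      refine Fin.cases ?_ (fun i => ?_) i
      · show (z - z') ⬝ᵥ (z + z' - (2 : ℂ) • W) = 0
        simp only [sub_dotProduct, dotProduct_sub, dotProduct_add, dotProduct_smul, hzz, hzz',
          hzW, hzW']
        rw [dotProduct_comm z' z]; ring
      · show w i ⬝ᵥ (z + z' - (2 : ℂ) • W) = 0
        rw [dotProduct_comm]
        simp only [sub_dotProduct, add_dotProduct, smul_dotProduct, hzw, hzw', hWw]
        simp; ring
    have hdet : M.det = 0 := Matrix.exists_mulVec_eq_zero_iff.mp ⟨_, hh, hMh⟩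
    obtain ⟨a, ha0, ha⟩ := Matrix.exists_vecMul_eq_zero_iff.mpr hdet
    have ha' : a 0 • (z - z') + ∑ i : Fin m, a i.succ • w i = 0 := by
      rw [← ha]
      ext k
      simp [Matrix.vecMul, dotProduct, Fin.sum_univ_succ, hM]
    have hG : ∀ j : Fin m, (p - b / 2) * (∑ i : Fin m, a i.succ) + b / 2 * a j.succ = 0 := by
      intro j
      have := congrArg (fun v => v ⬝ᵥ w j) ha'
      simp only [add_dotProduct, smul_dotProduct, sub_dotProduct, sum_dotProduct, hzw, hzw', hww,
        zero_dotProduct, smul_eq_mul, mul_add, Finset.sum_add_distrib, mul_ite, mul_zero,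
        Finset.sum_ite_eq', Finset.mem_univ, if_true, sub_self, zero_add] at this
      rw [← Finset.sum_mul] at this
      linear_combination this
    have hsum : ∑ i : Fin m, a i.succ = 0 := by
      have h1 : ∑ j : Fin m, ((p - b / 2) * (∑ i : Fin m, a i.succ) + b / 2 * a j.succ) = 0 :=
        Finset.sum_eq_zero fun j _ => hG j
      rw [Finset.sum_add_distrib, ← Finset.mul_sum, ← Finset.mul_sum] at h1
      simp only [Finset.sum_const, Finset.card_univ, Fintype.card_fin, nsmul_eq_mul] at h1
      have h2 : (m * ρ) * ∑ i : Fin m, a i.succ = 0 := by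
        rw [← hrow]; linear_combination h1
      exact (mul_eq_zero.mp h2).resolve_left (mul_ne_zero hm0 hρ)
    have haj : ∀ j : Fin m, a j.succ = 0 := by
      intro j
      have := hG j
      rw [hsum, mul_zero, zero_add] at this
      exact (mul_eq_zero.mp this).resolve_left (div_ne_zero hb two_ne_zero)
    simp only [haj, zero_smul, Finset.sum_const_zero, add_zero] at ha'
    rcases smul_eq_zero.mp ha' with h | h
    · apply ha0
      ext i
      exact Fin.cases h haj i
    · exact hu h
  have hXY : X - Y = (2 : ℂ) • (z - W) := by
    have h1 : X - Y = z - z' := by rw [hz, hz']; abel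
    rw [h1]
    have h2 : z' = (2 : ℂ) • W - z := by
      rw [← sub_eq_zero, ← hh]; abel
    rw [h2, smul_sub, two_smul ℂ z]; abel
  rw [phi_eq_dot, hXY]
  simp only [sub_dotProduct, dotProduct_sub, smul_dotProduct, dotProduct_smul, smul_eq_mul, hzz,
    hzW, hWW]
  rw [dotProduct_comm W z, hzW]
  ring

theorem kite_exists (m : ℕ) (hm : 1 ≤ m) (b p x c κ e : ℂ) (hκ : 2 * m * κ = m - 1)
    (hρ : p - κ * b ≠ 0) (he : e = 4 * c - (c + p - x) ^ 2 / (p - κ * b)) :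
    ∃ (Q : Fin m → Fin (m + 1) → ℂ) (P X Y : Fin (m + 1) → ℂ),
    (∀ i j, i ≠ j → phi (m + 1) (Q i) (Q j) = b) ∧
    (∀ i, phi (m + 1) (Q i) P = p) ∧
    (∀ i, phi (m + 1) X (Q i) = x) ∧ (∀ i, phi (m + 1) Y (Q i) = x) ∧
    phi (m + 1) X P = c ∧ phi (m + 1) Y P = c ∧ phi (m + 1) X Y = e := by
  have hm0 : (m : ℂ) ≠ 0 := by exact_mod_cast (by omega : m ≠ 0)
  obtain ⟨s, hs⟩ := IsAlgClosed.exists_pow_nat_eq (b / 2) (n := 2) (by norm_num)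
  obtain ⟨σ, hσ⟩ := IsAlgClosed.exists_pow_nat_eq ((p - κ * b) / m) (n := 2) (by norm_num)
  obtain ⟨β, hβ⟩ := IsAlgClosed.exists_pow_nat_eq (e / 4) (n := 2) (by norm_num)
  set ρ := p - κ * b with hρd
  have hσ0 : σ ≠ 0 := by
    rintro rfl
    have : ρ / m ≠ 0 := div_ne_zero hρ hm0
    apply this; rw [← hσ]; simp
  have hσ' : m * σ ^ 2 = ρ := by rw [hσ]; field_simp
  obtain ⟨τ, hτ⟩ : ∃ τ, 2 * m * σ * τ = ρ + (x - κ * b) - c :=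
    ⟨(ρ + (x - κ * b) - c) / (2 * m * σ), by field_simp⟩
  have hsum1 : ∀ (α : ℂ) (i : Fin m), ∑ k, (α - (Pi.single i s : Fin m → ℂ) k) ^ 2
      = m * α ^ 2 - 2 * α * s + s ^ 2 := by
    intro α i
    have : ∀ k, (α - (Pi.single i s : Fin m → ℂ) k) ^ 2
        = α ^ 2 + if k = i then (s ^ 2 - 2 * α * s) else 0 := by
      intro k
      by_cases h : k = i
      · subst h; simp; ring
      · simp [h]
    simp only [this, Finset.sum_add_distrib]
    simp
    ring
  have hsum1' : ∀ (α : ℂ) (i : Fin m), ∑ k, ((Pi.single i s : Fin m → ℂ) k - α) ^ 2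
      = m * α ^ 2 - 2 * α * s + s ^ 2 := by
    intro α i
    rw [← hsum1]
    exact Finset.sum_congr rfl fun k _ => by ring
  have hsum2 : ∀ i j : Fin m, i ≠ j →
      ∑ k, ((Pi.single i s : Fin m → ℂ) k - (Pi.single j s : Fin m → ℂ) k) ^ 2 = b := by
    intro i j hij
    have : ∀ k, ((Pi.single i s : Fin m → ℂ) k - (Pi.single j s : Fin m → ℂ) k) ^ 2
        = (if k = i then s ^ 2 else 0) + if k = j then s ^ 2 else 0 := by
      intro k
      by_cases h : k = i
      · subst h; simp [hij]
      · by_cases h' : k = j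
        · subst h'; simp [h]
        · simp [h, h']
    simp only [this, Finset.sum_add_distrib]
    simp [hs]
  have hα : ∀ σ : ℂ, m * (s / m + σ) ^ 2 - 2 * (s / m + σ) * s + s ^ 2 = m * σ ^ 2 + κ * b := by
    intro σ
    have : b = 2 * s ^ 2 := by rw [hs]; ring
    rw [this]
    have h2 : κ = (m - 1) / (2 * m) := by rw [← hκ]; field_simp
    rw [h2]; field_simp; ring
  have hτ2 : m * τ ^ 2 + β ^ 2 = x - κ * b := by
    have h3 : 4 * ρ * (m * τ ^ 2) = (ρ + (x - κ * b) - c) ^ 2 := by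
      rw [← hτ, ← hσ']; ring
    have h4 : 4 * ρ * (m * τ ^ 2 + β ^ 2) = 4 * ρ * (x - κ * b) := by
      rw [mul_add, h3, hβ, he]
      field_simp
      rw [hρd]; ring
    exact mul_left_cancel₀ (mul_ne_zero (by norm_num : (4 : ℂ) ≠ 0) hρ) h4
  refine ⟨fun i => Fin.cons 0 (Pi.single i s), Fin.cons 0 (fun _ => s / m + σ),
    Fin.cons β (fun _ => s / m + τ), Fin.cons (-β) (fun _ => s / m + τ), ?_, ?_, ?_, ?_, ?_, ?_, ?_⟩
  · intro i j hij
    simp only [phi, Fin.sum_univ_succ, Fin.cons_zero, Fin.cons_succ, hsum2 i j hij]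
    ring
  · intro i
    simp only [phi, Fin.sum_univ_succ, Fin.cons_zero, Fin.cons_succ, hsum1', hα, hσ']
    rw [hρd]; ring
  · intro i
    simp only [phi, Fin.sum_univ_succ, Fin.cons_zero, Fin.cons_succ, hsum1, hα]
    linear_combination hτ2
  · intro i
    simp only [phi, Fin.sum_univ_succ, Fin.cons_zero, Fin.cons_succ, hsum1, hα]
    linear_combination hτ2
  · simp only [phi, Fin.sum_univ_succ, Fin.cons_zero, Fin.cons_succ, Finset.sum_const,
      Finset.card_univ, Fintype.card_fin, nsmul_eq_mul]
    linear_combination hτ2 + hσ' - hτ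
  · simp only [phi, Fin.sum_univ_succ, Fin.cons_zero, Fin.cons_succ, Finset.sum_const,
      Finset.card_univ, Fintype.card_fin, nsmul_eq_mul]
    linear_combination hτ2 + hσ' - hτ
  · simp only [phi, Fin.sum_univ_succ, Fin.cons_zero, Fin.cons_succ, Finset.sum_const,
      Finset.card_univ, Fintype.card_fin, nsmul_eq_mul]
    linear_combination 4 * hβ

theorem det_kite (k : ℕ) (b p x c κ e : ℂ) (hκ : 2 * ((k + 1 : ℕ) : ℂ) * κ = ((k + 1 : ℕ) : ℂ) - 1)
    (hb0 : b ≠ 0) (hρ : p - κ * b ≠ 0) (he : e = 4 * c - (c + p - x) ^ 2 / (p - κ * b))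
    (he0 : e ≠ 0) (hb : Det (k + 2) b) (hp : Det (k + 2) p) (hx : Det (k + 2) x)
    (hc : Det (k + 2) c) : Det (k + 2) e := by
  classical
  apply det_of_weak k e he0
  intro X Y hXY
  obtain ⟨Q, P, X₀, Y₀, hQQ, hQP, hXQ, hYQ, hXP, hYP, hXY₀⟩ :=
    kite_exists (k + 1) (by omega) b p x c κ e hκ hρ he
  obtain ⟨g, hg, hgX, hgY⟩ := exists_isom (k + 2) X Y X₀ Y₀ (by rw [hXY]; exact hXY₀)
    (by rw [hXY]; exact he0)
  obtain ⟨S, hS⟩ := big (k + 2) (insert (g P) (insert (g X₀) (insert (g Y₀)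
    (Finset.univ.image fun i => g (Q i)))))
  refine ⟨S, fun f hf => ?_⟩
  have H : ∀ A B t, A ∈ (insert (g P) (insert (g X₀) (insert (g Y₀)
      (Finset.univ.image fun i => g (Q i))))) → B ∈ (insert (g P) (insert (g X₀) (insert (g Y₀)
      (Finset.univ.image fun i => g (Q i))))) → phi (k + 2) A B = t → Det (k + 2) t →
      phi (k + 2) (f A) (f B) = t := by
    intro A B t hA hB h ht
    subst h
    exact hS f hf A hA B hB ht
  rw [← hgX, ← hgY, he]
  refine kite_rigid (k + 1) (by omega) b p x c κ hκ hb0 hρ (fun i => f (g (Q i))) (f (g P))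
    (f (g X₀)) (f (g Y₀)) ?_ ?_ ?_ ?_ ?_ ?_
  · exact fun i j hij => H _ _ _ (by simp) (by simp) ((hg _ _).trans (hQQ i j hij)) hb
  · exact fun i => H _ _ _ (by simp) (by simp) ((hg _ _).trans (hQP i)) hp
  · exact fun i => H _ _ _ (by simp) (by simp) ((hg _ _).trans (hXQ i)) hx
  · exact fun i => H _ _ _ (by simp) (by simp) ((hg _ _).trans (hYQ i)) hx
  · exact H _ _ _ (by simp) (by simp) ((hg _ _).trans hXP) hc
  · exact H _ _ _ (by simp) (by simp) ((hg _ _).trans hYP) hc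

/-- For each n ≥ 2, D(ℂⁿ,ℂⁿ) is a dense subset of (0,∞). -/
theorem stmt_13 (n : ℕ) (hn : 2 ≤ n) :
    DCC n ⊆ Set.Ioi (0 : ℝ) ∧ Set.Ioi (0 : ℝ) ⊆ closure (DCC n) := by
  classical
  refine ⟨fun d hd => hd.1, ?_⟩
  obtain ⟨k, rfl⟩ : ∃ k, n = k + 2 := ⟨n - 2, by omega⟩
  intro d hd
  have hd0 : 0 < d := hd
  rw [Metric.mem_closure_iff]
  intro ε hε
  set l := max (d - ε) (d / 2) with hl
  have hl0 : 0 < l := lt_of_lt_of_le (by linarith) (le_max_right _ _)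
  have hld : l < d := max_lt (by linarith) (by linarith)
  have hlε : d - ε ≤ l := le_max_left _ _
  obtain ⟨s, ⟨hs0, hs⟩, hs1, hs2⟩ := aux_dense2 {t : ℝ | 0 < t ∧ Det (k + 2) (t : ℂ)}
    ((k : ℝ) / (2 * (k + 1))) (by positivity)
    (by rw [div_lt_div_iff₀ (by positivity) (by norm_num)]; linarith)
    (fun x hx => hx.1)
    (fun x hx y hy => ⟨mul_pos hx.1 hy.1, by
      push_cast
      exact det_mul _ _ _ (by exact_mod_cast hx.1.ne') hx.2 hy.2⟩)
    ⟨one_pos, by simpa using det_one (k + 2)⟩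
    (by
      intro b hb p hp x hx c hc hρ he
      refine ⟨he, ?_⟩
      refine det_kite k b p x c ((k : ℝ) / (2 * (k + 1)) : ℝ) _ ?_ ?_ ?_ ?_ ?_ hb.2 hp.2 hx.2 hc.2
      · have : (k : ℂ) + 1 ≠ 0 := by exact_mod_cast Nat.succ_ne_zero k
        push_cast
        field_simp
        ring
      · exact_mod_cast hb.1.ne'
      · exact_mod_cast hρ
      · push_cast; rfl
      · exact_mod_cast he.ne')
    (d ^ 2) (d ^ 2 / l ^ 2) (by positivity) (by
      rw [one_lt_div (by positivity)]
      gcongr)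
  have hls : l ^ 2 < s := by
    have h1 : d ^ 2 / l ^ 2 * s = d ^ 2 * (s / l ^ 2) := by ring
    rw [h1] at hs2
    have h2 : 1 < s / l ^ 2 := by
      by_contra hcon
      push Not at hcon
      have : d ^ 2 * (s / l ^ 2) ≤ d ^ 2 * 1 := by gcongr
      linarith
    rwa [one_lt_div (by positivity)] at h2
  have hq1 : l < √s := Real.lt_sqrt_of_sq_lt hls
  have hq2 : √s ≤ d := Real.sqrt_le_iff.mpr ⟨hd0.le, hs1⟩
  have hsq : ((√s : ℝ) : ℂ) ^ 2 = (s : ℂ) := by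
    rw [← Complex.ofReal_pow, Real.sq_sqrt hs0.le]
  refine ⟨√s, ⟨Real.sqrt_pos.mpr hs0, ?_⟩, ?_⟩
  · rw [hsq]
    intro X Y hXY
    obtain ⟨S, hS⟩ := hs X Y hXY
    refine ⟨insert X (insert Y S), by simp, by simp, fun f hf => hS f ?_⟩
    exact Pres.mono (T := insert X (insert Y S)) hf (fun z hz => by simp [hz])
  · rw [Real.dist_eq, abs_of_nonneg (by linarith)]
    linarith
end
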